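/- arXiv:2403.18618 — 13 statements merged into one kernel-verified Lean document; each statement's English description precedes it below -/
import Mathlib

section
/- Let H be a real Hilbert space, let M : H → H be a continuous self-adjoint positive semidefinite linear map with closed range, let F : H → H be M-nonexpansive, let w⁰ ∈ H, and let (w^k) be the Halpern iteration of F started at w⁰. Then for every w* ∈ H with F(w*) = w* and every k ≥ 0, one has ‖w^k − F(w^k)‖_M ≤ 2‖w⁰ − w*‖_M / (k+1). (This is Proposition 2.6(a): for the accelerated dPPM with α = 2, the seminorm residual ‖w^k − ŵ^{k+1}‖_M decays at the non-asymptotic rate O(1/k).) -/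
open scoped RealInnerProductSpace

namespace Halpern

variable {V : Type*} [AddCommGroup V] [Module ℝ V] {B : LinearMap.BilinForm ℝ V} {F : V → V}

/-- The displacement of a map that is nonexpansive for a symmetric bilinear form is
`1/2`-cocoercive for that form. -/
theorem displacement_cocoercive (hB : ∀ x y, B x y = B y x) {x y : V}
    (hF : B (F x - F y) (F x - F y) ≤ B (x - y) (x - y)) :
    B ((x - F x) - (y - F y)) ((x - F x) - (y - F y)) ≤
      2 * B ((x - F x) - (y - F y)) (x - y) := by
  have h : F x - F y = (x - y) - ((x - F x) - (y - F y)) := by abel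
  rw [h] at hF
  generalize (x - F x) - (y - F y) = r at hF ⊢
  generalize x - y = z at hF ⊢
  simp only [map_sub, LinearMap.sub_apply] at hF
  linarith [hB r z]

theorem sq_residual_le_inner_anchor (hB : ∀ x y, B x y = B y x)
    (hF : ∀ x y, B (F x - F y) (F x - F y) ≤ B (x - y) (x - y)) {w : ℕ → V}
    (hw : ∀ k : ℕ, w (k + 1) =
      (((k : ℝ) + 2)⁻¹) • w 0 + (((k : ℝ) + 1) / ((k : ℝ) + 2)) • F (w k)) (k : ℕ) :
    k * B (w k - F (w k)) (w k - F (w k)) ≤ 2 * B (w k - F (w k)) (w 0 - w k) := by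
  induction k with
  | zero => simp
  | succ k ih =>
    have hk : (0 : ℝ) < (k : ℝ) + 2 := by positivity
    have hstep : w (k + 1) - w k =
        ((k : ℝ) + 2)⁻¹ • ((w 0 - w k) - ((k : ℝ) + 1) • (w k - F (w k))) := by
      rw [hw k]
      match_scalars <;> field_simp <;> ring
    have hanchor : w 0 - w (k + 1) =
        (((k : ℝ) + 1) / ((k : ℝ) + 2)) • ((w 0 - w k) + (w k - F (w k))) := by
      rw [hw k]
      match_scalars <;> field_simp <;> ring
    have hco := displacement_cocoercive hB (hF (w (k + 1)) (w k))
    rw [hstep] at hco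
    rw [hanchor]
    generalize w (k + 1) - F (w (k + 1)) = s at hco ⊢
    generalize w k - F (w k) = r at hco ih ⊢
    generalize w 0 - w k = u at hco ih ⊢
    simp only [map_sub, map_add, map_smul, LinearMap.sub_apply, smul_eq_mul] at hco ⊢
    rw [hB r s, mul_left_comm, ← div_eq_inv_mul, ← sub_nonneg] at hco
    have hmul := mul_nonneg hk.le hco
    field_simp at hmul
    have hbound : ((k : ℝ) + 2) * B s s ≤ 2 * (B s u + B s r) := by
      linarith
    have hgoal := mul_le_mul_of_nonneg_left hbound
      (by positivity : 0 ≤ ((k : ℝ) + 1) / ((k : ℝ) + 2))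
    have hcancel : ((k : ℝ) + 1) / ((k : ℝ) + 2) * (((k : ℝ) + 2) * B s s) =
        ((k : ℝ) + 1) * B s s := by
      field_simp
    push_cast
    linarith

theorem sq_residual_le (hB : ∀ x y, B x y = B y x) (hpos : ∀ x, 0 ≤ B x x)
    (hF : ∀ x y, B (F x - F y) (F x - F y) ≤ B (x - y) (x - y)) {w : ℕ → V}
    (hw : ∀ k : ℕ, w (k + 1) =
      (((k : ℝ) + 2)⁻¹) • w 0 + (((k : ℝ) + 1) / ((k : ℝ) + 2)) • F (w k))
    {z : V} (hz : F z = z) (k : ℕ) :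
    ((k : ℝ) + 1) ^ 2 * B (w k - F (w k)) (w k - F (w k)) ≤ 4 * B (w 0 - z) (w 0 - z) := by
  have hanchor := sq_residual_le_inner_anchor hB hF hw k
  have hco := displacement_cocoercive hB (hF (w k) z)
  rw [hz, sub_self, sub_zero] at hco
  have hsplit : w 0 - z = (w 0 - w k) + (w k - z) := by abel
  have hsum : ((k : ℝ) + 1) * B (w k - F (w k)) (w k - F (w k)) ≤
      2 * B (w k - F (w k)) (w 0 - z) := by
    rw [hsplit, map_add]
    linarith
  generalize w k - F (w k) = r at hsum ⊢
  generalize w 0 - z = d at hsum ⊢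
  have hsq := hpos ((2 : ℝ) • d - ((k : ℝ) + 1) • r)
  simp only [map_sub, map_smul, LinearMap.sub_apply, LinearMap.smul_apply, smul_eq_mul] at hsq
  rw [hB d r] at hsq
  have hmul := mul_le_mul_of_nonneg_left hsum (by positivity : 0 ≤ (k : ℝ) + 1)
  linarith

end Halpern

/-- Proposition 2.6(a): non-asymptotic O(1/k) rate of the Halpern iteration of an
M-nonexpansive map, in the M-seminorm. -/
theorem halpern_seminorm_residual_rate
    {H : Type*} [NormedAddCommGroup H] [InnerProductSpace ℝ H] [CompleteSpace H]
    (M : H →L[ℝ] H)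
    (hMsa : ∀ w w' : H, ⟪M w, w'⟫ = ⟪w, M w'⟫)
    (hMpsd : ∀ w : H, 0 ≤ ⟪w, M w⟫)
    (hMrange : IsClosed (Set.range M))
    (F : H → H)
    (hF : ∀ w w' : H,
      Real.sqrt ⟪F w - F w', M (F w - F w')⟫ ≤ Real.sqrt ⟪w - w', M (w - w')⟫)
    (w0 : H) (w : ℕ → H) (hw0 : w 0 = w0)
    (hw : ∀ k : ℕ, w (k + 1) =
      (((k : ℝ) + 2)⁻¹) • w0 + (((k : ℝ) + 1) / ((k : ℝ) + 2)) • F (w k))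
    (wstar : H) (hfix : F wstar = wstar) :
    ∀ k : ℕ, Real.sqrt ⟪w k - F (w k), M (w k - F (w k))⟫ ≤
      2 * Real.sqrt ⟪w0 - wstar, M (w0 - wstar)⟫ / ((k : ℝ) + 1) := by
  subst hw0
  let B : LinearMap.BilinForm ℝ H := (innerₗ H).compl₂ (M : H →ₗ[ℝ] H)
  have hB : ∀ x y, B x y = B y x := fun x y => by
    change ⟪x, M y⟫ = ⟪y, M x⟫
    rw [← hMsa, real_inner_comm]
  intro k
  have hk : (0 : ℝ) < (k : ℝ) + 1 := by positivity
  have h := Halpern.sq_residual_le (B := B) hB hMpsd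
    (fun x y => (Real.sqrt_le_sqrt_iff (hMpsd _)).1 (hF x y)) hw hfix k
  change ((k : ℝ) + 1) ^ 2 * ⟪w k - F (w k), M (w k - F (w k))⟫ ≤
    4 * ⟪w 0 - wstar, M (w 0 - wstar)⟫ at h
  rw [le_div_iff₀ hk]
  refine (sq_le_sq₀ (by positivity) (by positivity)).1 ?_
  rw [mul_pow, mul_pow, Real.sq_sqrt (hMpsd _), Real.sq_sqrt (hMpsd _)]
  linarith
end

section
/- Let H be a real Hilbert space, let M : H → H be a continuous self-adjoint positive semidefinite linear map with closed range, let F : H → H be M-nonexpansive, and suppose there exists w* ∈ H with F(w*) = w*. Fix α > 2 and w⁰ ∈ H, and define sequences by ŵ⁰ := w⁰, ŵ^{k+1} := F(w^k), and w^{k+1} := w^k + (α/(2(k+α)))(ŵ^{k+1} − w^k) + (k/(k+α))(ŵ^{k+1} − ŵ^k) for all k ≥ 0. Then (k+1)·‖w^{k+1} − w^k‖_M → 0 and (k+1)·‖w^k − ŵ^{k+1}‖_M → 0 as k → ∞; that is, both ‖w^{k+1} − w^k‖_M and ‖w^k − F(w^k)‖_M are o(1/(k+1)). (This is Proposition 2.6(b):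 asymptotic o(1/k) rates of the accelerated dPPM with α > 2.) -/
open scoped RealInnerProductSpace

/-- If `e (k + 1) + t k ≤ e k + s k` with all terms nonnegative and `s` summable, then `t` is
summable and `e` converges. -/
lemma summable_and_tendsto_of_quasi_descent {e s t : ℕ → ℝ} (he : ∀ k, 0 ≤ e k)
    (hs : ∀ k, 0 ≤ s k) (ht : ∀ k, 0 ≤ t k) (hsum : Summable s)
    (h : ∀ k, e (k + 1) + t k ≤ e k + s k) :
    Summable t ∧ ∃ L, Filter.Tendsto e Filter.atTop (nhds L) := by
  have hle : ∀ n, ∑ i ∈ Finset.range n, s i ≤ ∑' i, s i := fun n =>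
    hsum.sum_le_tsum _ fun i _ => hs i
  have hpart : ∀ n, e n + ∑ i ∈ Finset.range n, t i ≤ e 0 + ∑ i ∈ Finset.range n, s i := by
    intro n
    induction n with
    | zero => simp
    | succ n ih =>
      rw [Finset.sum_range_succ, Finset.sum_range_succ]
      linarith [h n]
  refine ⟨summable_of_sum_range_le (c := e 0 + ∑' i, s i) ht fun n => ?_, ?_⟩
  · linarith [hpart n, he n, hle n]
  · have hanti : Antitone fun n => e n - ∑ i ∈ Finset.range n, s i :=
      antitone_nat_of_succ_le fun n => by
        rw [Finset.sum_range_succ]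
        linarith [h n, ht n]
    have hbdd : BddBelow (Set.range fun n => e n - ∑ i ∈ Finset.range n, s i) :=
      ⟨-∑' i, s i, by
        rintro _ ⟨n, rfl⟩
        linarith [he n, hle n]⟩
    have hlim := (tendsto_atTop_ciInf hanti hbdd).add hsum.hasSum.tendsto_sum_nat
    exact ⟨_, hlim.congr fun n => by ring⟩

/-- A nonnegative quasi-descent sequence tends to zero when it is dominated by `k` times its
decrease. -/
lemma tendsto_zero_of_quasi_descent {e s t : ℕ → ℝ} {C : ℝ} (he : ∀ k, 0 ≤ e k)
    (hs : ∀ k, 0 ≤ s k) (ht : ∀ k, 0 ≤ t k) (hsum : Summable s)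
    (h : ∀ k, e (k + 1) + t k ≤ e k + s k) (hC : 0 < C)
    (hdom : ∀ k : ℕ, e (k + 1) ≤ C * ((k : ℝ) + 1) * t k) :
    Filter.Tendsto e Filter.atTop (nhds 0) := by
  obtain ⟨htsum, L, hL⟩ := summable_and_tendsto_of_quasi_descent he hs ht hsum h
  have hL0 : 0 ≤ L := ge_of_tendsto' hL he
  rcases hL0.eq_or_lt with rfl | hpos
  · exact hL
  exfalso
  have hev : ∀ᶠ k : ℕ in Filter.atTop, L / 2 < e (k + 1) :=
    ((Filter.tendsto_add_atTop_iff_nat 1).2 hL).eventually (lt_mem_nhds (by linarith))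
  obtain ⟨N, hN⟩ := Filter.eventually_atTop.1 hev
  have hharm : Summable fun k : ℕ => L / (2 * C) * (1 / (((k + N : ℕ) : ℝ) + 1)) := by
    refine Summable.of_nonneg_of_le (fun k => by positivity) (fun k => ?_)
      ((summable_nat_add_iff N).2 htsum)
    have h1 := hN (k + N) (Nat.le_add_left _ _)
    have h2 := hdom (k + N)
    have h3 : (0 : ℝ) < ((k + N : ℕ) : ℝ) + 1 := by positivity
    rw [div_mul_div_comm, mul_one, div_le_iff₀ (by positivity)]
    linarith
  have hne : L / (2 * C) ≠ 0 := by positivity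
  have h1 := (summable_mul_left_iff hne).1 hharm
  have h2 : Summable fun k : ℕ => 1 / ((k : ℝ) + 1) := (summable_nat_add_iff N).1 h1
  have h3 : Summable fun k : ℕ => 1 / (k : ℝ) :=
    (summable_nat_add_iff 1).1 (by simpa using h2)
  exact Real.not_summable_one_div_natCast h3

/-- Scalar form of the convergence analysis: `P`, `D` and `R` stand for `‖p‖²`, `‖r‖²` and
`⟨p, r⟩`, and `U` is the squared norm of the auxiliary sequence in the Lyapunov function. -/
lemma tendsto_zero_of_lyapunov {α : ℝ} (hα : 2 < α) {P D R U : ℕ → ℝ}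
    (hP : ∀ k, 0 ≤ P k) (hD : ∀ k, 0 ≤ D k) (hU : ∀ k, 0 ≤ U k)
    (hR : ∀ k (t : ℝ), 0 ≤ P k + 2 * t * R k + t ^ 2 * D k)
    (hUP : ∀ k : ℕ, α * U (k + 1) + (α - 2) * (((k : ℝ) + α) ^ 2 * P (k + 1)) ≤
      α * U k + (α - 2) * ((k : ℝ) ^ 2 * P k))
    (hPrec : ∀ k : ℕ, ((k : ℝ) + α) ^ 2 * P (k + 1) =
      (k + α / 2) ^ 2 * P k - α * (k + α / 2) * R k + α ^ 2 / 4 * D k)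
    (hDrec : ∀ k : ℕ, ((k : ℝ) + α) ^ 2 * D (k + 1) ≤
      (k + α / 2) ^ 2 * D k - α * (k + α / 2) * R k + α ^ 2 / 4 * P k) :
    Filter.Tendsto (fun k : ℕ => ((k : ℝ) + 1) ^ 2 * P k) Filter.atTop (nhds 0) ∧
    Filter.Tendsto (fun k : ℕ => ((k : ℝ) + 1) ^ 2 * D k) Filter.atTop (nhds 0) := by
  have hα0 : 0 < α := by linarith
  have hδ : 0 < α / 2 - 1 := by linarith
  have hα2 : 0 < α - 2 := by linarith
  have hα1 : 0 < α - 1 := by linarith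
  have hPsum : Summable fun k : ℕ => ((k : ℝ) + α / 2) * P k := by
    have h1 := (summable_and_tendsto_of_quasi_descent
      (e := fun k : ℕ => α * U k + (α - 2) * ((k : ℝ) ^ 2 * P k)) (s := fun _ => 0)
      (t := fun k : ℕ => (α - 2) * (α - 1) * ((2 * (k : ℝ) + 1 + α) * P (k + 1)))
      (fun k => by have := hP k; have := hU k; positivity) (fun _ => le_rfl)
      (fun k => by have := hP (k + 1); positivity) summable_zero
      (fun k => by
        have := hUP k
        push_cast
        linarith)).1
    have h2 := (summable_mul_left_iff (by positivity : (α - 2) * (α - 1) ≠ 0)).1 h1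
    refine (summable_nat_add_iff 1).1 (Summable.of_nonneg_of_le (fun k => ?_) (fun k => ?_) h2)
    · have := hP (k + 1)
      positivity
    · refine mul_le_mul_of_nonneg_right ?_ (hP _)
      have : (0 : ℝ) ≤ k := k.cast_nonneg
      push_cast
      linarith
  have hdescD : ∀ k : ℕ,
      ((k + 1 : ℕ) + α / 2) * ((k + 1 : ℕ) + α - 1) * D (k + 1) +
        (α / 2 - 1) * (k + α) * D (k + 1) ≤
      ((k : ℝ) + α / 2) * (k + α - 1) * D k +
        (α ^ 2 / (4 * (α / 2 - 1)) + α) * ((k + α / 2) * P k) := by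
    intro k
    have hcross : -(α * R k) ≤ (α / 2 - 1) * D k + α ^ 2 / (4 * (α / 2 - 1)) * P k := by
      have h1 := hR k (2 * (α / 2 - 1) / α)
      have h2 := mul_nonneg (by positivity : 0 ≤ α ^ 2 / (4 * (α / 2 - 1))) h1
      have h3 : α ^ 2 / (4 * (α / 2 - 1)) * (P k + 2 * (2 * (α / 2 - 1) / α) * R k +
          (2 * (α / 2 - 1) / α) ^ 2 * D k) =
          α ^ 2 / (4 * (α / 2 - 1)) * P k + α * R k + (α / 2 - 1) * D k := by
        generalize α / 2 - 1 = δ at hδ ⊢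
        field_simp
        ring
      linarith
    have hk : (0 : ℝ) ≤ k + α / 2 := by positivity
    have h1 := mul_le_mul_of_nonneg_left hcross hk
    have h2 : α ^ 2 / 4 * P k ≤ α * ((k + α / 2) * P k) := by
      have := mul_nonneg (mul_nonneg hα0.le (by positivity : (0 : ℝ) ≤ k + α / 4)) (hP k)
      linarith
    have h3 := hDrec k
    push_cast
    linarith
  have hsD : Summable fun k : ℕ =>
      (α ^ 2 / (4 * (α / 2 - 1)) + α) * (((k : ℝ) + α / 2) * P k) := hPsum.mul_left _
  have hfD : ∀ k : ℕ, 0 ≤ ((k : ℝ) + α / 2) * (k + α - 1) * D k := fun k => by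
    have := hD k
    have : 0 ≤ (k : ℝ) + α - 1 := by
      have : (0 : ℝ) ≤ k := k.cast_nonneg
      linarith
    positivity
  have hs0 : ∀ k : ℕ, 0 ≤ (α ^ 2 / (4 * (α / 2 - 1)) + α) * (((k : ℝ) + α / 2) * P k) :=
    fun k => by have := hP k; positivity
  have ht0 : ∀ k : ℕ, 0 ≤ (α / 2 - 1) * ((k : ℝ) + α) * D (k + 1) :=
    fun k => by have := hD (k + 1); positivity
  have hDsum : Summable fun k : ℕ => ((k : ℝ) + α / 2) * D k := by
    have h1 := (summable_and_tendsto_of_quasi_descent hfD hs0 ht0 hsD hdescD).1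
    simp only [mul_assoc] at h1
    have h2 := (summable_mul_left_iff hδ.ne').1 h1
    refine (summable_nat_add_iff 1).1 (Summable.of_nonneg_of_le (fun k => ?_) (fun k => ?_) h2)
    · have := hD (k + 1)
      positivity
    · refine mul_le_mul_of_nonneg_right ?_ (hD _)
      push_cast
      linarith
  have hlimD := tendsto_zero_of_quasi_descent (C := α / (α / 2 - 1)) hfD hs0 ht0 hsD hdescD
    (by positivity) (fun k => by
      have h1 : α / (α / 2 - 1) * ((k : ℝ) + 1) * ((α / 2 - 1) * (k + α) * D (k + 1)) =
          (α * (k + 1)) * (k + α) * D (k + 1) := by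
        generalize α / 2 - 1 = δ at hδ ⊢
        field_simp
      rw [h1]
      push_cast
      have h2 : (k : ℝ) + 1 + α / 2 ≤ α * (k + 1) := by
        have : (0 : ℝ) ≤ k := k.cast_nonneg
        nlinarith
      have h3 : (k : ℝ) + 1 + α - 1 = k + α := by ring
      rw [h3]
      exact mul_le_mul_of_nonneg_right (mul_le_mul_of_nonneg_right h2 (by positivity)) (hD _))
  have hlimP := tendsto_zero_of_quasi_descent (C := 2 / (α - 2))
    (e := fun k : ℕ => ((k : ℝ) + 1) ^ 2 * P k)
    (s := fun k : ℕ => 2 * α * (((k : ℝ) + α / 2) * P k + (k + α / 2) * D k))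
    (t := fun k : ℕ => (α - 2) * (2 * k + 2 + α) * P (k + 1))
    (fun k => by have := hP k; positivity)
    (fun k => by have := hP k; have := hD k; positivity)
    (fun k => by have := hP (k + 1); positivity)
    ((hPsum.add hDsum).mul_left _)
    (fun k => by
      have h1 := hPrec k
      have h2 := hR k 1
      have hk : (0 : ℝ) ≤ k := k.cast_nonneg
      have h3 := mul_nonneg (by positivity : 0 ≤ α * ((k : ℝ) + α / 2)) h2
      have h4 := mul_nonneg (by positivity : 0 ≤ α * (k : ℝ)) (hP k)
      have h5 := mul_nonneg (by positivity : 0 ≤ α * (k : ℝ)) (hD k)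
      have h6 := mul_nonneg (by positivity : 0 ≤ α ^ 2) (hP k)
      have h7 := mul_nonneg (by positivity : 0 ≤ α ^ 2) (hD k)
      have h8 := mul_nonneg (by positivity : 0 ≤ 2 * (k : ℝ) + 1) (hP k)
      push_cast
      linarith)
    (by positivity)
    (fun k => by
      have h1 : 2 / (α - 2) * ((k : ℝ) + 1) * ((α - 2) * (2 * k + 2 + α) * P (k + 1)) =
          2 * (k + 1) * (2 * k + 2 + α) * P (k + 1) := by
        field_simp
      rw [h1]
      refine mul_le_mul_of_nonneg_right ?_ (hP _)
      have hk : (0 : ℝ) ≤ k := k.cast_nonneg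
      push_cast
      nlinarith [mul_nonneg hk hk, mul_nonneg hk hα0.le])
  refine ⟨hlimP, squeeze_zero (fun k => ?_) (fun k => ?_) hlimD⟩
  · have := hD k
    positivity
  · refine mul_le_mul_of_nonneg_right ?_ (hD k)
    have hk : (0 : ℝ) ≤ k := k.cast_nonneg
    rw [pow_two]
    exact mul_le_mul (by linarith) (by linarith) (by positivity) (by positivity)

section QuadraticForm

variable {H : Type*} [NormedAddCommGroup H] [InnerProductSpace ℝ H] {M : H →L[ℝ] H}

/-- Expansion of the quadratic form of a symmetric operator on a linear combination. -/
lemma inner_map_smul_add_smul (hMsa : ∀ w w' : H, ⟪M w, w'⟫ = ⟪w, M w'⟫) (a b : ℝ) (x y : H) :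
    ⟪a • x + b • y, M (a • x + b • y)⟫ =
      a ^ 2 * ⟪x, M x⟫ + 2 * a * b * ⟪x, M y⟫ + b ^ 2 * ⟪y, M y⟫ := by
  have h : ⟪y, M x⟫ = ⟪x, M y⟫ := by rw [real_inner_comm, hMsa]
  simp only [map_add, map_smul, inner_add_left, inner_add_right, real_inner_smul_left,
    real_inner_smul_right, h]
  ring

lemma inner_map_sub_le (hMsa : ∀ w w' : H, ⟪M w, w'⟫ = ⟪w, M w'⟫)
    (hMpsd : ∀ w : H, 0 ≤ ⟪w, M w⟫) (x y : H) :
    ⟪x - y, M (x - y)⟫ ≤ 2 * ⟪x, M x⟫ + 2 * ⟪y, M y⟫ := by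
  have h1 := inner_map_smul_add_smul hMsa 1 1 x y
  have h2 := inner_map_smul_add_smul hMsa 1 (-1) x y
  have h3 := hMpsd ((1 : ℝ) • x + (1 : ℝ) • y)
  rw [show x - y = (1 : ℝ) • x + (-1 : ℝ) • y by module]
  linarith

end QuadraticForm

/-- Proposition 2.6(b): asymptotic o(1/k) rates of the accelerated dPPM (fast
Krasnosel'skii-Mann iteration) with parameter α > 2, in the M-seminorm. -/
theorem fastKM_seminorm_residual_little_o
    {H : Type*} [NormedAddCommGroup H] [InnerProductSpace ℝ H] [CompleteSpace H]
    (M : H →L[ℝ] H)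
    (hMsa : ∀ w w' : H, ⟪M w, w'⟫ = ⟪w, M w'⟫)
    (hMpsd : ∀ w : H, 0 ≤ ⟪w, M w⟫)
    (hMrange : IsClosed (Set.range M))
    (F : H → H)
    (hF : ∀ w w' : H,
      Real.sqrt ⟪F w - F w', M (F w - F w')⟫ ≤ Real.sqrt ⟪w - w', M (w - w')⟫)
    (wstar : H) (hfix : F wstar = wstar)
    (α : ℝ) (hα : 2 < α)
    (w0 : H) (w wh : ℕ → H)
    (hwh0 : wh 0 = w0) (hw0 : w 0 = w0)
    (hwh : ∀ k : ℕ, wh (k + 1) = F (w k))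
    (hw : ∀ k : ℕ, w (k + 1) = w k
      + (α / (2 * ((k : ℝ) + α))) • (wh (k + 1) - w k)
      + ((k : ℝ) / ((k : ℝ) + α)) • (wh (k + 1) - wh k)) :
    Filter.Tendsto
      (fun k : ℕ => ((k : ℝ) + 1) *
        Real.sqrt ⟪w (k + 1) - w k, M (w (k + 1) - w k)⟫)
      Filter.atTop (nhds 0) ∧
    Filter.Tendsto
      (fun k : ℕ => ((k : ℝ) + 1) *
        Real.sqrt ⟪w k - wh (k + 1), M (w k - wh (k + 1))⟫)
      Filter.atTop (nhds 0) := by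
  have hFsq : ∀ w w' : H, ⟪F w - F w', M (F w - F w')⟫ ≤ ⟪w - w', M (w - w')⟫ := fun w w' =>
    (Real.sqrt_le_sqrt_iff (hMpsd _)).1 (hF w w')
  have hα0 : 0 < α := by linarith
  set q : H → ℝ := fun x => ⟪x, M x⟫
  have hexp : ∀ (a b : ℝ) (x y : H),
      q (a • x + b • y) = a ^ 2 * q x + 2 * a * b * ⟪x, M y⟫ + b ^ 2 * q y :=
    inner_map_smul_add_smul hMsa
  have hscale : ∀ (a : ℝ) (x : H), q (a • x) = a ^ 2 * q x := fun a x => by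
    simpa using hexp a 0 x 0
  let p : ℕ → H := fun k => w k - wh k
  let r : ℕ → H := fun k => wh (k + 1) - wh k
  let u : ℕ → H := fun k => (α - 1) • (w k - wstar) + (k : ℝ) • p k
  have hstep : ∀ k : ℕ, ((k : ℝ) + α) • (w (k + 1) - w k) =
      (k : ℝ) • p k - (k + α / 2) • (w k - wh (k + 1)) := by
    intro k
    have hk : (k : ℝ) + α ≠ 0 := by positivity
    have h1 : ((k : ℝ) + α) * (α / (2 * (k + α))) = α / 2 := by field_simp
    have h2 : ((k : ℝ) + α) * (k / (k + α)) = k := by field_simp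
    rw [hw k, add_assoc, add_sub_cancel_left, smul_add, smul_smul, smul_smul, h1, h2]
    simp only [p]
    module
  have hpstep : ∀ k : ℕ, ((k : ℝ) + α) • p (k + 1) =
      (k + α / 2 : ℝ) • p k + (-(α / 2)) • r k := by
    intro k
    have h1 : p (k + 1) = (w (k + 1) - w k) + (w k - wh (k + 1)) := by
      simp only [p]
      abel
    rw [h1, smul_add, hstep k]
    simp only [p, r]
    module
  have hdstep : ∀ k : ℕ, ((k : ℝ) + α) • (w (k + 1) - w k) =
      (-(α / 2)) • p k + (k + α / 2 : ℝ) • r k := by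
    intro k
    rw [hstep k]
    simp only [p, r]
    module
  have hustep : ∀ k : ℕ, u (k + 1) = (1 : ℝ) • u k + (-(α / 2 - 1)) • (w k - wh (k + 1)) := by
    intro k
    have h1 : u (k + 1) = ((k : ℝ) + α) • (w (k + 1) - w k) + (α - 1) • (w k - wstar) +
        ((k : ℝ) + 1) • (w k - wh (k + 1)) := by
      simp only [u, p]
      push_cast
      module
    rw [h1, hstep k]
    simp only [u]
    module
  have hPrec : ∀ k : ℕ, ((k : ℝ) + α) ^ 2 * q (p (k + 1)) =
      (k + α / 2) ^ 2 * q (p k) - α * (k + α / 2) * ⟪p k, M (r k)⟫ + α ^ 2 / 4 * q (r k) := by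
    intro k
    rw [← hscale, hpstep k, hexp]
    ring
  have hDrec : ∀ k : ℕ, ((k : ℝ) + α) ^ 2 * q (r (k + 1)) ≤
      (k + α / 2) ^ 2 * q (r k) - α * (k + α / 2) * ⟪p k, M (r k)⟫ + α ^ 2 / 4 * q (p k) := by
    intro k
    have h1 : q (r (k + 1)) ≤ q (w (k + 1) - w k) := by
      simp only [r, hwh]
      exact hFsq _ _
    have h2 := mul_le_mul_of_nonneg_left h1 (sq_nonneg ((k : ℝ) + α))
    rw [← hscale _ (w (k + 1) - w k), hdstep k, hexp] at h2
    linarith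
  have hcoco : ∀ k : ℕ, q (w k - wh (k + 1)) ≤
      2 * ⟪w k - wstar, M (w k - wh (k + 1))⟫ := by
    intro k
    have h1 : q (wh (k + 1) - wstar) ≤ q (w k - wstar) := by
      have := hFsq (w k) wstar
      rwa [hfix, ← hwh] at this
    rw [show wh (k + 1) - wstar = (1 : ℝ) • (w k - wstar) + (-1 : ℝ) • (w k - wh (k + 1)) by
      module, hexp] at h1
    linarith
  have hG : ∀ k, q (w k - wh (k + 1)) = q (p k) - 2 * ⟪p k, M (r k)⟫ + q (r k) := by
    intro k
    rw [show w k - wh (k + 1) = (1 : ℝ) • p k + (-1 : ℝ) • r k by simp only [p, r]; module, hexp]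
    ring
  have hUP : ∀ k : ℕ,
      α * q (u (k + 1)) + (α - 2) * (((k : ℝ) + α) ^ 2 * q (p (k + 1))) ≤
      α * q (u k) + (α - 2) * ((k : ℝ) ^ 2 * q (p k)) := by
    intro k
    have h1 : ⟪u k, M (w k - wh (k + 1))⟫ =
        (α - 1) * ⟪w k - wstar, M (w k - wh (k + 1))⟫ + k * (q (p k) - ⟪p k, M (r k)⟫) := by
      have h2 : ⟪p k, M (w k - wh (k + 1))⟫ = q (p k) - ⟪p k, M (r k)⟫ := by
        rw [show w k - wh (k + 1) = p k - r k by simp only [p, r]; abel, map_sub,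
          inner_sub_right]
      simp only [u, inner_add_left, real_inner_smul_left, h2]
    have h3 := mul_nonneg
      (mul_nonneg (mul_nonneg hα0.le (by linarith : 0 ≤ α - 2)) (by linarith : 0 ≤ α - 1))
      (sub_nonneg.2 (hcoco k))
    rw [hustep k, hexp, hPrec k, h1]
    rw [hG k] at h3 ⊢
    linarith
  obtain ⟨hP, hD⟩ := tendsto_zero_of_lyapunov hα (P := fun k => q (p k)) (D := fun k => q (r k))
    (R := fun k => ⟪p k, M (r k)⟫) (U := fun k => q (u k)) (fun _ => hMpsd _) (fun _ => hMpsd _)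
    (fun _ => hMpsd _)
    (fun k t => by
      have := hMpsd ((1 : ℝ) • p k + t • r k)
      rw [inner_map_smul_add_smul hMsa] at this
      linarith)
    hUP hPrec hDrec
  have hGlim : Filter.Tendsto (fun k : ℕ => ((k : ℝ) + 1) ^ 2 * q (w k - wh (k + 1)))
      Filter.atTop (nhds 0) := by
    refine squeeze_zero (fun k => mul_nonneg (sq_nonneg _) (hMpsd _)) (fun k => ?_)
      (by simpa using (hP.add hD).const_mul 2)
    have h1 := inner_map_sub_le hMsa hMpsd (p k) (r k)
    rw [show p k - r k = w k - wh (k + 1) by simp only [p, r]; abel] at h1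
    have h2 := mul_le_mul_of_nonneg_left h1 (sq_nonneg ((k : ℝ) + 1))
    linarith
  have hdlim : Filter.Tendsto (fun k : ℕ => ((k : ℝ) + 1) ^ 2 * q (w (k + 1) - w k))
      Filter.atTop (nhds 0) := by
    refine squeeze_zero (fun k => mul_nonneg (sq_nonneg _) (hMpsd _)) (fun k => ?_)
      (by simpa using (((Filter.tendsto_add_atTop_iff_nat 1).2 hP).add hGlim).const_mul 2)
    have h1 := inner_map_sub_le hMsa hMpsd (p (k + 1)) (w k - wh (k + 1))
    rw [show p (k + 1) - (w k - wh (k + 1)) = w (k + 1) - w k by simp only [p]; abel] at h1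
    have h2 := mul_le_mul_of_nonneg_left h1 (sq_nonneg ((k : ℝ) + 1))
    have h3 := mul_nonneg (by positivity : (0 : ℝ) ≤ 2 * k + 3) (hMpsd (p (k + 1)))
    linarith
  have hsqrt : ∀ f : ℕ → H,
      Filter.Tendsto (fun k : ℕ => ((k : ℝ) + 1) ^ 2 * q (f k)) Filter.atTop (nhds 0) →
      Filter.Tendsto (fun k : ℕ => ((k : ℝ) + 1) * Real.sqrt (q (f k)))
        Filter.atTop (nhds 0) := by
    intro f hf
    have h1 := hf.sqrt
    rw [Real.sqrt_zero] at h1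
    refine h1.congr fun k => ?_
    rw [Real.sqrt_mul (sq_nonneg _), Real.sqrt_sq (by positivity)]
  exact ⟨hsqrt _ hdlim, hsqrt _ hGlim⟩
end

section
/- Let H be a real Hilbert space, let M : H → H be a continuous self-adjoint positive semidefinite linear map with closed range, and let F : H → H be M-nonexpansive. Suppose moreover that there is a constant κ ≥ 0 with ‖F(w) − F(w')‖ ≤ κ·‖w − w'‖_M for all w, w' ∈ H (in the paper, F = (M+T)⁻¹M and κ = L‖C‖, where (M+T)⁻¹ is L-Lipschitz and M = CC*). Let w* ∈ H satisfy F(w*) = w*, let w⁰ ∈ H, and let (w^k) be the Halpern iteration of F started at w⁰. Then for all k ≥ 0: ‖w^k − F(w^k)‖ ≤ (1/(k+1))·‖w⁰ − w*‖ + ((5k+1)/(k+1)²)·κ·‖w⁰ − w*‖_M. In particular the residual in the norm of H decays at rate O(1/k) even though M may be only positive semidefinite. (Corollary 2.7.) -/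
open scoped RealInnerProductSpace

section Halpern

variable {E : Type*} [SeminormedAddCommGroup E] [InnerProductSpace ℝ E] {F : E → E} {p : E}
  {w : ℕ → E}

/-- The Halpern iteration of a nonexpansive map stays in the ball around a fixed point whose
radius is the initial distance. -/
theorem halpern_norm_sub_fixedPoint_le (hF : ∀ x y, ‖F x - F y‖ ≤ ‖x - y‖) (hp : F p = p)
    (hw : ∀ k : ℕ, w (k + 1) =
      (((k : ℝ) + 2)⁻¹) • w 0 + (((k : ℝ) + 1) / ((k : ℝ) + 2)) • F (w k)) (k : ℕ) :
    ‖w k - p‖ ≤ ‖w 0 - p‖ := by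
  induction k with
  | zero => rfl
  | succ k ih =>
    have hk : (k : ℝ) + 2 ≠ 0 := by positivity
    have hFk : ‖F (w k) - p‖ ≤ ‖w 0 - p‖ := by
      simpa only [hp] using (hF (w k) p).trans ih
    have heq : w (k + 1) - p = (((k : ℝ) + 2)⁻¹) • (w 0 - p) +
        (((k : ℝ) + 1) / ((k : ℝ) + 2)) • (F (w k) - p) := by
      rw [hw k]
      match_scalars <;> field_simp <;> ring
    calc ‖w (k + 1) - p‖
        ≤ ((k : ℝ) + 2)⁻¹ * ‖w 0 - p‖ + (((k : ℝ) + 1) / ((k : ℝ) + 2)) * ‖F (w k) - p‖ := by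
          rw [heq]
          refine (norm_add_le _ _).trans_eq ?_
          rw [norm_smul_of_nonneg (by positivity), norm_smul_of_nonneg (by positivity)]
      _ ≤ ((k : ℝ) + 2)⁻¹ * ‖w 0 - p‖ + (((k : ℝ) + 1) / ((k : ℝ) + 2)) * ‖w 0 - p‖ := by
          gcongr
      _ = ‖w 0 - p‖ := by
          field_simp
          ring

/-- A nonexpansive map decreases the distance of two points, expressed through residuals. -/
theorem norm_sq_residual_sub_le (hF : ∀ x y, ‖F x - F y‖ ≤ ‖x - y‖) (x y : E) :
    ‖(x - F x) - (y - F y)‖ ^ 2 ≤ 2 * inner ℝ ((x - F x) - (y - F y)) (x - y) := by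
  have h := pow_le_pow_left₀ (norm_nonneg _) (hF x y) 2
  have heq : F x - F y = (x - y) - ((x - F x) - (y - F y)) := by abel
  rw [heq, norm_sub_sq_real, real_inner_comm] at h
  linarith

/-- The potential of the Halpern iteration is nonpositive. -/
theorem halpern_potential_nonpos (hF : ∀ x y, ‖F x - F y‖ ≤ ‖x - y‖)
    (hw : ∀ k : ℕ, w (k + 1) =
      (((k : ℝ) + 2)⁻¹) • w 0 + (((k : ℝ) + 1) / ((k : ℝ) + 2)) • F (w k)) (k : ℕ) :
    k * ‖w k - F (w k)‖ ^ 2 ≤ 2 * inner ℝ (w k - F (w k)) (w 0 - w k) := by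
  induction k with
  | zero => simp
  | succ k ih =>
    have h1 : (k : ℝ) + 1 ≠ 0 := by positivity
    have h2 : (k : ℝ) + 2 ≠ 0 := by positivity
    have h := norm_sq_residual_sub_le hF (w (k + 1)) (w k)
    have hprev : w (k + 1) - w k = ((k : ℝ) + 2)⁻¹ • (w 0 - w k) -
        (((k : ℝ) + 1) / ((k : ℝ) + 2)) • (w k - F (w k)) := by
      rw [hw k]
      match_scalars <;> field_simp <;> ring
    have hnext : w (k + 1) - w k = ((k : ℝ) + 1)⁻¹ • (w 0 - w (k + 1)) - (w k - F (w k)) := by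
      rw [hw k]
      match_scalars <;> field_simp <;> ring
    rw [inner_sub_left] at h
    nth_rewrite 1 [hnext] at h
    rw [hprev] at h
    generalize w (k + 1) - F (w (k + 1)) = u' at h ⊢
    generalize w k - F (w k) = u at h ih ⊢
    rw [norm_sub_sq_real, inner_sub_right, inner_sub_right, inner_smul_right, inner_smul_right,
      inner_smul_right, real_inner_self_eq_norm_sq] at h
    generalize inner ℝ u' (w 0 - w (k + 1)) = b at h ⊢
    generalize inner ℝ u (w 0 - w k) = a at h ih
    generalize inner ℝ u' u = c at h
    have hstep : ((k : ℝ) + 1) * ‖u'‖ ^ 2 - 2 * b ≤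
        (((k : ℝ) + 1) / ((k : ℝ) + 2)) * (k * ‖u‖ ^ 2 - 2 * a) := by
      have h' := mul_le_mul_of_nonneg_left h (by positivity : (0 : ℝ) ≤ (k : ℝ) + 1)
      field_simp at h' ⊢
      linarith
    have hneg : (((k : ℝ) + 1) / ((k : ℝ) + 2)) * (k * ‖u‖ ^ 2 - 2 * a) ≤ 0 :=
      mul_nonpos_of_nonneg_of_nonpos (by positivity) (by linarith)
    push_cast
    linarith

/-- Lieder's tight bound on the residual of the Halpern iteration. -/
theorem halpern_norm_residual_le (hF : ∀ x y, ‖F x - F y‖ ≤ ‖x - y‖) (hp : F p = p)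
    (hw : ∀ k : ℕ, w (k + 1) =
      (((k : ℝ) + 2)⁻¹) • w 0 + (((k : ℝ) + 1) / ((k : ℝ) + 2)) • F (w k)) (k : ℕ) :
    (k + 1) * ‖w k - F (w k)‖ ≤ 2 * ‖w 0 - p‖ := by
  have hpot := halpern_potential_nonpos hF hw k
  have hfix := norm_sq_residual_sub_le hF (w k) p
  rw [hp, sub_self, sub_zero] at hfix
  have hcs := real_inner_le_norm (w k - F (w k)) (w 0 - p)
  rw [← sub_add_sub_cancel (w 0) (w k) p, inner_add_right, sub_add_sub_cancel] at hcs
  rcases (norm_nonneg (w k - F (w k))).eq_or_lt with h0 | h0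
  · rw [← h0]
    simp
  · refine le_of_mul_le_mul_left ?_ h0
    linarith

/-- Consecutive Halpern iterates approach each other at rate `O(1/k)`. -/
theorem halpern_norm_sub_succ_le (hF : ∀ x y, ‖F x - F y‖ ≤ ‖x - y‖) (hp : F p = p)
    (hw : ∀ k : ℕ, w (k + 1) =
      (((k : ℝ) + 2)⁻¹) • w 0 + (((k : ℝ) + 1) / ((k : ℝ) + 2)) • F (w k)) (k : ℕ) :
    ‖w k - w (k + 1)‖ ≤ 4 / (k + 2) * ‖w 0 - p‖ := by
  have h2 : (k : ℝ) + 2 ≠ 0 := by positivity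
  have hres := halpern_norm_residual_le hF hp hw k
  have hball := halpern_norm_sub_fixedPoint_le hF hp hw k
  have hdist : ‖w k - w 0‖ ≤ 2 * ‖w 0 - p‖ := by
    have := norm_sub_le (w k - p) (w 0 - p)
    rw [sub_sub_sub_cancel_right] at this
    linarith
  have heq : w k - w (k + 1) = ((k : ℝ) + 2)⁻¹ • (w k - w 0) +
      (((k : ℝ) + 1) / ((k : ℝ) + 2)) • (w k - F (w k)) := by
    rw [hw k]
    match_scalars <;> field_simp <;> ring
  rw [heq]
  refine (norm_add_le _ _).trans ?_
  rw [norm_smul_of_nonneg (by positivity), norm_smul_of_nonneg (by positivity)]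
  field_simp
  linarith

end Halpern

/-- The semi-inner product `⟪x, M y⟫` of a symmetric positive semidefinite operator `M`. -/
@[reducible]
def ContinuousLinearMap.preInnerCore {H : Type*} [NormedAddCommGroup H] [InnerProductSpace ℝ H]
    (M : H →L[ℝ] H) (hMsa : ∀ w w' : H, ⟪M w, w'⟫ = ⟪w, M w'⟫)
    (hMpsd : ∀ w : H, 0 ≤ ⟪w, M w⟫) : PreInnerProductSpace.Core ℝ H where
  inner x y := ⟪x, M y⟫
  conj_inner_symm x y := by
    rw [conj_trivial, ← hMsa, real_inner_comm]
  re_inner_nonneg x := hMpsd x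
  add_left x y z := inner_add_left x y (M z)
  smul_left x y r := inner_smul_left x (M y) r

/-- Corollary 2.7: O(1/k) rate of the Halpern iteration residual in the norm of H,
even though the preconditioner M may be only positive semidefinite. -/
theorem halpern_norm_residual_rate
    {H : Type*} [NormedAddCommGroup H] [InnerProductSpace ℝ H] [CompleteSpace H]
    (M : H →L[ℝ] H)
    (hMsa : ∀ w w' : H, ⟪M w, w'⟫ = ⟪w, M w'⟫)
    (hMpsd : ∀ w : H, 0 ≤ ⟪w, M w⟫)
    (hMrange : IsClosed (Set.range M))
    (F : H → H)
    (hF : ∀ w w' : H,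
      Real.sqrt ⟪F w - F w', M (F w - F w')⟫ ≤ Real.sqrt ⟪w - w', M (w - w')⟫)
    (κ : ℝ) (hκ : 0 ≤ κ)
    (hFlip : ∀ w w' : H, ‖F w - F w'‖ ≤ κ * Real.sqrt ⟪w - w', M (w - w')⟫)
    (wstar : H) (hfix : F wstar = wstar)
    (w0 : H) (w : ℕ → H) (hw0 : w 0 = w0)
    (hw : ∀ k : ℕ, w (k + 1) =
      (((k : ℝ) + 2)⁻¹) • w0 + (((k : ℝ) + 1) / ((k : ℝ) + 2)) • F (w k)) :
    ∀ k : ℕ, ‖w k - F (w k)‖ ≤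
      (1 / ((k : ℝ) + 1)) * ‖w0 - wstar‖ +
      ((5 * (k : ℝ) + 1) / ((k : ℝ) + 1) ^ 2) * κ *
        Real.sqrt ⟪w0 - wstar, M (w0 - wstar)⟫ := by
  subst hw0
  let c := M.preInnerCore hMsa hMpsd
  have hball : ∀ k, √⟪w k - wstar, M (w k - wstar)⟫ ≤ √⟪w 0 - wstar, M (w 0 - wstar)⟫ :=
    @halpern_norm_sub_fixedPoint_le H (@InnerProductSpace.Core.toSeminormedAddCommGroup ℝ H _ _ _ c)
      (@InnerProductSpace.ofCore ℝ H _ _ _ c) F wstar w hF hfix hw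
  have hsucc : ∀ k : ℕ, √⟪w k - w (k + 1), M (w k - w (k + 1))⟫ ≤
      4 / (k + 2) * √⟪w 0 - wstar, M (w 0 - wstar)⟫ :=
    @halpern_norm_sub_succ_le H (@InnerProductSpace.Core.toSeminormedAddCommGroup ℝ H _ _ _ c)
      (@InnerProductSpace.ofCore ℝ H _ _ _ c) F wstar w hF hfix hw
  generalize √⟪w 0 - wstar, M (w 0 - wstar)⟫ = R at hball hsucc ⊢
  have hanchor : ∀ k, ‖w 0 - F (w k)‖ ≤ ‖w 0 - wstar‖ + κ * R := by
    intro k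
    have h := norm_sub_le (w 0 - wstar) (F (w k) - F wstar)
    rw [hfix, sub_sub_sub_cancel_right] at h
    have h' := (hFlip (w k) wstar).trans (mul_le_mul_of_nonneg_left (hball k) hκ)
    rw [hfix] at h'
    linarith
  intro k
  cases k with
  | zero => simpa using hanchor 0
  | succ k =>
    have h2 : (k : ℝ) + 2 ≠ 0 := by positivity
    have hFsucc : ‖F (w k) - F (w (k + 1))‖ ≤ κ * (4 / (k + 2) * R) :=
      (hFlip _ _).trans (mul_le_mul_of_nonneg_left (hsucc k) hκ)
    have heq : w (k + 1) - F (w (k + 1)) = ((k : ℝ) + 2)⁻¹ • (w 0 - F (w (k + 1))) +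
        (((k : ℝ) + 1) / ((k : ℝ) + 2)) • (F (w k) - F (w (k + 1))) := by
      nth_rewrite 1 [hw k]
      match_scalars <;> field_simp <;> ring
    calc ‖w (k + 1) - F (w (k + 1))‖
        ≤ ((k : ℝ) + 2)⁻¹ * ‖w 0 - F (w (k + 1))‖ +
          (((k : ℝ) + 1) / ((k : ℝ) + 2)) * ‖F (w k) - F (w (k + 1))‖ := by
          rw [heq]
          refine (norm_add_le _ _).trans_eq ?_
          rw [norm_smul_of_nonneg (by positivity), norm_smul_of_nonneg (by positivity)]
      _ ≤ ((k : ℝ) + 2)⁻¹ * (‖w 0 - wstar‖ + κ * R) +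
          (((k : ℝ) + 1) / ((k : ℝ) + 2)) * (κ * (4 / (k + 2) * R)) := by
          gcongr
          exact hanchor _
      _ = _ := by
          push_cast
          rw [show (k : ℝ) + 1 + 1 = k + 2 by ring]
          field_simp
          ring
end

section
/- Let V be a real normed vector space, let ρ ∈ (0, 2), let w⁰ ∈ V, and let (w̄^k) be a sequence in V converging (in norm) to a point w* ∈ V. Define the sequence (w^k) by the given w⁰ and w^{k+1} := (1/(k+2)) w⁰ + ((k+1)/(k+2)) ((1−ρ) w^k + ρ w̄^k) for all k ≥ 0. Then w^k → w* and also ŵ^{k+1} := (1−ρ) w^k + ρ w̄^k → w* as k → ∞. (This is the key step in the proof of Theorem 2.5(a): strong convergence of the sequences {w^k} and {ŵ^k} of the accelerated dPPM with α = 2 and relaxation factor ρ ∈ (0,2), given strong convergence of {w̄^k}.) -/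
/-- A nonnegative sequence that contracts up to a vanishing perturbation tends to zero. -/
theorem tendsto_zero_of_le_mul_add {a b : ℕ → ℝ} {q : ℝ} (hq0 : 0 ≤ q) (hq1 : q < 1)
    (ha : ∀ k, 0 ≤ a k) (hb : Filter.Tendsto b Filter.atTop (nhds 0))
    (hab : ∀ k, a (k + 1) ≤ q * a k + b k) :
    Filter.Tendsto a Filter.atTop (nhds 0) := by
  refine tendsto_order.2 ⟨fun c hc => Filter.Eventually.of_forall fun k => hc.trans_le (ha k),
    fun ε hε => ?_⟩
  have hδ : 0 < (1 - q) * (ε / 2) := mul_pos (by linarith) (by linarith)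
  obtain ⟨N, hN⟩ := Filter.eventually_atTop.1 (hb.eventually_lt_const hδ)
  have key : ∀ m, a (m + N) ≤ q ^ m * a N + ε / 2 := by
    intro m
    induction m with
    | zero => simp only [zero_add, pow_zero, one_mul]; linarith
    | succ m ih =>
      have h1 := hab (m + N)
      have h2 := hN (m + N) (by omega)
      have h3 := mul_le_mul_of_nonneg_left ih hq0
      rw [add_right_comm, pow_succ]
      linarith
  have hlim : Filter.Tendsto (fun m => q ^ m * a N) Filter.atTop (nhds 0) := by
    simpa using (tendsto_pow_atTop_nhds_zero_of_lt_one hq0 hq1).mul_const (a N)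
  obtain ⟨M, hM⟩ := Filter.eventually_atTop.1 (hlim.eventually_lt_const (half_pos hε))
  refine Filter.eventually_atTop.2 ⟨M + N, fun k hk => ?_⟩
  have h1 := key (k - N)
  have h2 := hM (k - N) (by omega)
  rw [Nat.sub_add_cancel (by omega)] at h1
  linarith

/-- Key step in the proof of Theorem 2.5(a): strong convergence of the sequences
{w^k} and {ŵ^k} of the accelerated dPPM with α = 2 and relaxation factor ρ ∈ (0,2),
given strong convergence of {w̄^k}. -/
theorem halpern_relaxed_convergence
    {V : Type*} [NormedAddCommGroup V] [NormedSpace ℝ V]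
    (ρ : ℝ) (hρ0 : 0 < ρ) (hρ2 : ρ < 2)
    (w0 : V) (wbar : ℕ → V) (wstar : V)
    (hwbar : Filter.Tendsto wbar Filter.atTop (nhds wstar))
    (w : ℕ → V) (hw0 : w 0 = w0)
    (hw : ∀ k : ℕ, w (k + 1) =
      (((k : ℝ) + 2)⁻¹) • w0 +
      (((k : ℝ) + 1) / ((k : ℝ) + 2)) • ((1 - ρ) • w k + ρ • wbar k)) :
    Filter.Tendsto w Filter.atTop (nhds wstar) ∧
    Filter.Tendsto (fun k : ℕ => (1 - ρ) • w k + ρ • wbar k)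
      Filter.atTop (nhds wstar) := by
  have hw_lim : Filter.Tendsto w Filter.atTop (nhds wstar) := by
    rw [tendsto_iff_norm_sub_tendsto_zero] at hwbar ⊢
    have hinv : Filter.Tendsto (fun k : ℕ => ((k : ℝ) + 2)⁻¹) Filter.atTop (nhds 0) :=
      tendsto_inv_atTop_zero.comp
        (Filter.tendsto_atTop_add_const_right _ _ tendsto_natCast_atTop_atTop)
    have hb : Filter.Tendsto
        (fun k : ℕ => ((k : ℝ) + 2)⁻¹ * ‖w0 - wstar‖ + ρ * ‖wbar k - wstar‖)
        Filter.atTop (nhds 0) := by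
      simpa using (hinv.mul_const ‖w0 - wstar‖).add (hwbar.const_mul ρ)
    refine tendsto_zero_of_le_mul_add (abs_nonneg (1 - ρ))
      (abs_lt.2 ⟨by linarith, by linarith⟩) (fun k => norm_nonneg _) hb fun k => ?_
    have hk : (0 : ℝ) < (k : ℝ) + 2 := by positivity
    have ht0 : (0 : ℝ) ≤ ((k : ℝ) + 1) / ((k : ℝ) + 2) := by positivity
    have ht1 : ((k : ℝ) + 1) / ((k : ℝ) + 2) ≤ 1 := (div_le_one hk).2 (by linarith)
    have hst : ((k : ℝ) + 2)⁻¹ = 1 - ((k : ℝ) + 1) / ((k : ℝ) + 2) := by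
      field_simp
      ring
    have hs0 : 0 ≤ ((k : ℝ) + 2)⁻¹ := by positivity
    have heq : w (k + 1) - wstar = ((k : ℝ) + 2)⁻¹ • (w0 - wstar) +
        (((k : ℝ) + 1) / ((k : ℝ) + 2)) •
          ((1 - ρ) • (w k - wstar) + ρ • (wbar k - wstar)) := by
      rw [hw, hst]
      module
    have hin : ‖(1 - ρ) • (w k - wstar) + ρ • (wbar k - wstar)‖ ≤
        |1 - ρ| * ‖w k - wstar‖ + ρ * ‖wbar k - wstar‖ := by
      refine (norm_add_le _ _).trans_eq ?_
      rw [norm_smul, norm_smul, Real.norm_eq_abs, Real.norm_of_nonneg hρ0.le]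
    calc ‖w (k + 1) - wstar‖
        ≤ ((k : ℝ) + 2)⁻¹ * ‖w0 - wstar‖ + (((k : ℝ) + 1) / ((k : ℝ) + 2)) *
            ‖(1 - ρ) • (w k - wstar) + ρ • (wbar k - wstar)‖ := by
          rw [heq]
          refine (norm_add_le _ _).trans_eq ?_
          rw [norm_smul, norm_smul, Real.norm_of_nonneg hs0, Real.norm_of_nonneg ht0]
      _ ≤ |1 - ρ| * ‖w k - wstar‖ +
            (((k : ℝ) + 2)⁻¹ * ‖w0 - wstar‖ + ρ * ‖wbar k - wstar‖) := by
          linarith [mul_le_of_le_one_left (norm_nonneg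
            ((1 - ρ) • (w k - wstar) + ρ • (wbar k - wstar))) ht1]
  refine ⟨hw_lim, ?_⟩
  have h := (hw_lim.const_smul (1 - ρ)).add (hwbar.const_smul ρ)
  rwa [← add_smul, sub_add_cancel, one_smul] at h
end

section
/- In the two-block setting, let (y*, z*, x*) ∈ Y × Z × X be a KKT point, let ρ ∈ (0, 2], k ∈ ℕ, R₀ ≥ 0, and let w = (y, z, x) ∈ W and w̄ = (ȳ, z̄, x̄) ∈ W satisfy: (1) x̄ = x + σ(B₁y + B₂z̄ − c); (2) −B₂*x̄ − T₂(z̄ − z) ∈ ∂f₂(z̄); (3) −B₁*(x̄ + σ(B₁ȳ + B₂z̄ − c)) − T₁(ȳ − y) ∈ ∂f₁(ȳ); (4) ‖w̄ − w‖_M ≤ 2R₀/(ρ(k+1)); and (5) ‖w̄ − w*‖_M ≤ R₀, where w* = (y*, z*, x*). Then the primal objective function value gap h(ȳ, z̄) := f₁(ȳ) + f₂(z̄) − f₁(y*) − f₂(z*) satisfies −(2R₀‖x*‖)/(√σ·ρ·(k+1)) ≤ h(ȳ, z̄) ≤ (3R₀ + ‖x*‖/√σ) · 2R₀/(ρ(k+1)).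 (This is the primal objective-gap bound of Theorem 3.4(a) for the accelerated pADMM with α = 2.) -/
open scoped RealInnerProductSpace

/-- Cauchy-Schwarz inequality for the seminorm of a self-adjoint positive semidefinite map. -/
theorem neg_inner_le_of_posSemidef {E : Type*} [NormedAddCommGroup E] [InnerProductSpace ℝ E]
    (T : E →ₗ[ℝ] E) (hsa : ∀ u v : E, ⟪T u, v⟫ = ⟪u, T v⟫) (hpsd : ∀ u : E, 0 ≤ ⟪u, T u⟫)
    {u v : E} {a b : ℝ} (ha : 0 ≤ a) (hb : 0 ≤ b)
    (hu : ⟪u, T u⟫ ≤ a ^ 2) (hv : ⟪v, T v⟫ ≤ b ^ 2) : -⟪T u, v⟫ ≤ a * b := by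
  have hquad : ∀ t : ℝ, 0 ≤ ⟪u, T u⟫ * (t * t) + 2 * ⟪T u, v⟫ * t + ⟪v, T v⟫ := by
    intro t
    have h := hpsd (t • u + v)
    have hvu : ⟪v, T u⟫ = ⟪T u, v⟫ := real_inner_comm _ _
    simp only [map_add, map_smul, inner_add_left, inner_add_right, real_inner_smul_left,
      real_inner_smul_right, ← hsa u v, hvu] at h
    linarith
  have hdiscrim := discrim_le_zero hquad
  unfold discrim at hdiscrim
  have hmul : ⟪u, T u⟫ * ⟪v, T v⟫ ≤ a ^ 2 * b ^ 2 :=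
    mul_le_mul hu hv (hpsd v) (sq_nonneg a)
  have habs : |⟪T u, v⟫| ≤ a * b := abs_le_of_sq_le_sq (by nlinarith) (mul_nonneg ha hb)
  linarith [neg_le_abs ⟪T u, v⟫]

/-- Theorem 3.4(a), primal objective-gap bound for the accelerated pADMM with α = 2. -/
theorem acc_pADMM_objective_gap_bound
    {Y Z X : Type*}
    [NormedAddCommGroup Y] [InnerProductSpace ℝ Y] [FiniteDimensional ℝ Y]
    [NormedAddCommGroup Z] [InnerProductSpace ℝ Z] [FiniteDimensional ℝ Z]
    [NormedAddCommGroup X] [InnerProductSpace ℝ X] [FiniteDimensional ℝ X]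
    (B1 : Y →ₗ[ℝ] X) (B2 : Z →ₗ[ℝ] X) (c : X) (σ : ℝ) (hσ : 0 < σ)
    (f1 : Y → ℝ) (f2 : Z → ℝ)
    (hf1 : ConvexOn ℝ Set.univ f1) (hf2 : ConvexOn ℝ Set.univ f2)
    (T1 : Y →ₗ[ℝ] Y) (T2 : Z →ₗ[ℝ] Z)
    (hT1sa : ∀ u v : Y, ⟪T1 u, v⟫ = ⟪u, T1 v⟫) (hT1psd : ∀ u : Y, 0 ≤ ⟪u, T1 u⟫)
    (hT2sa : ∀ u v : Z, ⟪T2 u, v⟫ = ⟪u, T2 v⟫) (hT2psd : ∀ u : Z, 0 ≤ ⟪u, T2 u⟫)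
    -- KKT point (y*, z*, x*)
    (ystar : Y) (zstar : Z) (xstar : X)
    (hKKT1 : ∀ y' : Y, f1 ystar + ⟪-(B1.adjoint xstar), y' - ystar⟫ ≤ f1 y')
    (hKKT2 : ∀ z' : Z, f2 zstar + ⟪-(B2.adjoint xstar), z' - zstar⟫ ≤ f2 z')
    (hKKT3 : B1 ystar + B2 zstar = c)
    (ρ : ℝ) (hρ0 : 0 < ρ) (hρ2 : ρ ≤ 2) (k : ℕ) (R0 : ℝ) (hR0 : 0 ≤ R0)
    (y ybar : Y) (z zbar : Z) (x xbar : X)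
    -- (1) multiplier update
    (h1 : xbar = x + σ • (B1 y + B2 zbar - c))
    -- (2) optimality inclusion for z̄
    (h2 : ∀ z' : Z, f2 zbar + ⟪-(B2.adjoint xbar) - T2 (zbar - z), z' - zbar⟫ ≤ f2 z')
    -- (3) optimality inclusion for ȳ
    (h3 : ∀ y' : Y, f1 ybar +
      ⟪-(B1.adjoint (xbar + σ • (B1 ybar + B2 zbar - c))) - T1 (ybar - y), y' - ybar⟫
      ≤ f1 y')
    -- (4) M-seminorm bound on w̄ - w
    (h4 : Real.sqrt (⟪ybar - y, T1 (ybar - y)⟫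
        + σ⁻¹ * ‖σ • B1 (ybar - y) + (xbar - x)‖ ^ 2
        + ⟪zbar - z, T2 (zbar - z)⟫) ≤ 2 * R0 / (ρ * ((k : ℝ) + 1)))
    -- (5) M-seminorm bound on w̄ - w*
    (h5 : Real.sqrt (⟪ybar - ystar, T1 (ybar - ystar)⟫
        + σ⁻¹ * ‖σ • B1 (ybar - ystar) + (xbar - xstar)‖ ^ 2
        + ⟪zbar - zstar, T2 (zbar - zstar)⟫) ≤ R0) :
    -(2 * R0 * ‖xstar‖) / (Real.sqrt σ * ρ * ((k : ℝ) + 1)) ≤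
      f1 ybar + f2 zbar - f1 ystar - f2 zstar ∧
    f1 ybar + f2 zbar - f1 ystar - f2 zstar ≤
      (3 * R0 + ‖xstar‖ / Real.sqrt σ) * (2 * R0 / (ρ * ((k : ℝ) + 1))) := by
  set ε : ℝ := 2 * R0 / (ρ * ((k : ℝ) + 1)) with hε
  have hε0 : 0 ≤ ε := by positivity
  set s : ℝ := Real.sqrt σ with hs
  have hs0 : 0 < s := Real.sqrt_pos.mpr hσ
  have hsσ : σ = s ^ 2 := (Real.sq_sqrt hσ.le).symm
  set r : X := B1 ybar + B2 zbar - c with hr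
  set p : X := σ • B1 (ybar - ystar) + (xbar - xstar) with hp
  have hres : σ • B1 (ybar - y) + (xbar - x) = σ • r := by
    rw [h1, hr, map_sub]
    module
  have hfeas : B1 (ybar - ystar) + B2 (zbar - zstar) = r := by
    rw [hr, ← hKKT3, map_sub, map_sub]
    abel
  rw [hres] at h4
  rw [Real.sqrt_le_left hε0] at h4
  rw [Real.sqrt_le_left hR0] at h5
  have hdy := hT1psd (ybar - y)
  have hdz := hT2psd (zbar - z)
  have hey := hT1psd (ybar - ystar)
  have hez := hT2psd (zbar - zstar)
  have hrsq : σ⁻¹ * ‖σ • r‖ ^ 2 = (s * ‖r‖) ^ 2 := by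
    rw [norm_smul, Real.norm_of_nonneg hσ.le, hsσ]
    field_simp
  have hpsq : σ⁻¹ * ‖p‖ ^ 2 = (‖p‖ / s) ^ 2 := by
    rw [hsσ]
    field_simp
  rw [hrsq] at h4
  rw [hpsq] at h5
  have hrε : s * ‖r‖ ≤ ε :=
    (sq_le_sq₀ (by positivity) hε0).mp (by linarith)
  have hpR : ‖p‖ / s ≤ R0 := (sq_le_sq₀ (by positivity) hR0).mp (by linarith [sq_nonneg (s * ‖r‖)])
  have hT1 : -⟪T1 (ybar - y), ybar - ystar⟫ ≤ ε * R0 :=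
    neg_inner_le_of_posSemidef T1 hT1sa hT1psd hε0 hR0
      (by linarith [sq_nonneg (s * ‖r‖)]) (by linarith [sq_nonneg (‖p‖ / s)])
  have hT2 : -⟪T2 (zbar - z), zbar - zstar⟫ ≤ ε * R0 :=
    neg_inner_le_of_posSemidef T2 hT2sa hT2psd hε0 hR0
      (by linarith [sq_nonneg (s * ‖r‖)]) (by linarith [sq_nonneg (‖p‖ / s)])
  have hpr : -⟪p, r⟫ ≤ R0 * ε := by
    have hprod : ‖p‖ * ‖r‖ = ‖p‖ / s * (s * ‖r‖) := by field_simp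
    have hle : ‖p‖ / s * (s * ‖r‖) ≤ R0 * ε := by gcongr
    linarith [neg_le_abs ⟪p, r⟫, abs_real_inner_le_norm p r]
  have hxr : |⟪xstar, r⟫| ≤ ‖xstar‖ / s * ε := by
    have hprod : ‖xstar‖ * ‖r‖ = ‖xstar‖ / s * (s * ‖r‖) := by field_simp
    have hle : ‖xstar‖ / s * (s * ‖r‖) ≤ ‖xstar‖ / s * ε := by gcongr
    linarith [abs_real_inner_le_norm xstar r]
  constructor
  · have hy := hKKT1 ybar
    have hz := hKKT2 zbar
    rw [inner_neg_left, LinearMap.adjoint_inner_left] at hy hz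
    have hsum : ⟪xstar, r⟫ = ⟪xstar, B1 (ybar - ystar)⟫ + ⟪xstar, B2 (zbar - zstar)⟫ := by
      rw [← hfeas, inner_add_right]
    have hbound : -(2 * R0 * ‖xstar‖) / (s * ρ * ((k : ℝ) + 1)) = -(‖xstar‖ / s * ε) := by
      rw [hε]
      field_simp
    rw [hbound]
    linarith [le_abs_self ⟪xstar, r⟫]
  · have hy := h3 ystar
    have hz := h2 zstar
    rw [← neg_sub ybar ystar, inner_neg_right, inner_sub_left, inner_neg_left,
      LinearMap.adjoint_inner_left, inner_add_left, real_inner_smul_left] at hy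
    rw [← neg_sub zbar zstar, inner_neg_right, inner_sub_left, inner_neg_left,
      LinearMap.adjoint_inner_left] at hz
    have hsum : ⟪xbar, r⟫ = ⟪xbar, B1 (ybar - ystar)⟫ + ⟪xbar, B2 (zbar - zstar)⟫ := by
      rw [← hfeas, inner_add_right]
    have hsplit : ⟪p, r⟫ = σ * ⟪r, B1 (ybar - ystar)⟫ + (⟪xbar, r⟫ - ⟪xstar, r⟫) := by
      rw [hp, inner_add_left, real_inner_smul_left, inner_sub_left,
        real_inner_comm r (B1 (ybar - ystar))]
    linarith [neg_le_abs ⟪xstar, r⟫]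
end

section
/- In the two-block setting, let ε ≥ 0 and let w = (y, z, x) ∈ W and w̄ = (ȳ, z̄, x̄) ∈ W satisfy x̄ = x + σ(B₁y + B₂z̄ − c) and ‖w̄ − w‖_M ≤ ε. Then the primal feasibility violation satisfies ‖B₁ȳ + B₂z̄ − c‖ ≤ ε/√σ. In particular, if ‖w̄ − w‖_M ≤ 2R₀/(ρ(k+1)) for some R₀ ≥ 0, ρ > 0 and k ∈ ℕ, then ‖B₁ȳ + B₂z̄ − c‖ ≤ 2R₀/(√σ·ρ·(k+1)). (This is the primal feasibility bound established in the proof of Theorem 3.4(a).) -/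
open scoped RealInnerProductSpace

/-- Primal feasibility bound from the proof of Theorem 3.4(a). -/
theorem acc_pADMM_feasibility_bound
    {Y Z X : Type*}
    [NormedAddCommGroup Y] [InnerProductSpace ℝ Y] [FiniteDimensional ℝ Y]
    [NormedAddCommGroup Z] [InnerProductSpace ℝ Z] [FiniteDimensional ℝ Z]
    [NormedAddCommGroup X] [InnerProductSpace ℝ X] [FiniteDimensional ℝ X]
    (B1 : Y →ₗ[ℝ] X) (B2 : Z →ₗ[ℝ] X) (c : X) (σ : ℝ) (hσ : 0 < σ)
    (T1 : Y →ₗ[ℝ] Y) (T2 : Z →ₗ[ℝ] Z)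
    (hT1sa : ∀ u v : Y, ⟪T1 u, v⟫ = ⟪u, T1 v⟫) (hT1psd : ∀ u : Y, 0 ≤ ⟪u, T1 u⟫)
    (hT2sa : ∀ u v : Z, ⟪T2 u, v⟫ = ⟪u, T2 v⟫) (hT2psd : ∀ u : Z, 0 ≤ ⟪u, T2 u⟫)
    (ε : ℝ) (hε : 0 ≤ ε)
    (y ybar : Y) (z zbar : Z) (x xbar : X)
    (h1 : xbar = x + σ • (B1 y + B2 zbar - c))
    (hM : Real.sqrt (⟪ybar - y, T1 (ybar - y)⟫
        + σ⁻¹ * ‖σ • B1 (ybar - y) + (xbar - x)‖ ^ 2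
        + ⟪zbar - z, T2 (zbar - z)⟫) ≤ ε) :
    ‖B1 ybar + B2 zbar - c‖ ≤ ε / Real.sqrt σ ∧
    (∀ (R0 ρ : ℝ) (k : ℕ), 0 ≤ R0 → 0 < ρ →
      Real.sqrt (⟪ybar - y, T1 (ybar - y)⟫
        + σ⁻¹ * ‖σ • B1 (ybar - y) + (xbar - x)‖ ^ 2
        + ⟪zbar - z, T2 (zbar - z)⟫) ≤ 2 * R0 / (ρ * ((k : ℝ) + 1)) →
      ‖B1 ybar + B2 zbar - c‖ ≤ 2 * R0 / (Real.sqrt σ * ρ * ((k : ℝ) + 1))) := by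
  have hvec : σ • B1 (ybar - y) + (xbar - x) = σ • (B1 ybar + B2 zbar - c) := by
    rw [h1, map_sub]
    module
  have key : √σ * ‖B1 ybar + B2 zbar - c‖ ≤ Real.sqrt (⟪ybar - y, T1 (ybar - y)⟫
      + σ⁻¹ * ‖σ • B1 (ybar - y) + (xbar - x)‖ ^ 2
      + ⟪zbar - z, T2 (zbar - z)⟫) := by
    apply Real.le_sqrt_of_sq_le
    have hsq : σ⁻¹ * ‖σ • B1 (ybar - y) + (xbar - x)‖ ^ 2
        = (√σ * ‖B1 ybar + B2 zbar - c‖) ^ 2 := by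
      rw [hvec, norm_smul, Real.norm_of_nonneg hσ.le, mul_pow, mul_pow, Real.sq_sqrt hσ.le]
      field_simp
    linarith [hT1psd (ybar - y), hT2psd (zbar - z)]
  have hs : 0 < √σ := Real.sqrt_pos.mpr hσ
  refine ⟨(le_div_iff₀' hs).mpr (key.trans hM), fun R0 ρ k _ _ h => ?_⟩
  rw [mul_assoc, mul_comm (√σ), ← div_div]
  exact (le_div_iff₀' hs).mpr (key.trans h)
end

section
/- Let H be a real inner product space, M : H → H a continuous self-adjoint positive semidefinite linear map, T : H → Set(H) a monotone set-valued operator, and T̂ : H → H a map induced by (M, T), with Q̂ w := w − T̂ w. Then T̂ is M-firmly nonexpansive: for all w, w' ∈ H, ‖T̂ w − T̂ w'‖_M² + ‖Q̂ w − Q̂ w'‖_M² ≤ ‖w − w'‖_M². (Proposition 2.2(c).) -/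
open scoped RealInnerProductSpace

/-- Proposition 2.2(c): T̂ is M-firmly nonexpansive. -/
theorem dPPM_M_firmly_nonexpansive
    {H : Type*} [NormedAddCommGroup H] [InnerProductSpace ℝ H]
    (M : H →L[ℝ] H)
    (hMsa : ∀ w w' : H, ⟪M w, w'⟫ = ⟪w, M w'⟫)
    (hMpsd : ∀ w : H, 0 ≤ ⟪w, M w⟫)
    (T : H → Set H)
    (hT : ∀ w w' v v' : H, v ∈ T w → v' ∈ T w' → 0 ≤ ⟪v - v', w - w'⟫)
    (That : H → H)
    (hThat : ∀ w : H, M w - M (That w) ∈ T (That w)) :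
    ∀ w w' : H,
      ⟪That w - That w', M (That w - That w')⟫ +
      ⟪(w - That w) - (w' - That w'), M ((w - That w) - (w' - That w'))⟫ ≤
      ⟪w - w', M (w - w')⟫ := by
  intro w w'
  have hmono := hT _ _ _ _ (hThat w) (hThat w')
  set a := That w - That w' with ha
  set b := (w - That w) - (w' - That w') with hb
  have hsum : w - w' = a + b := by rw [ha, hb]; abel
  have hMb : M w - M (That w) - (M w' - M (That w')) = M b := by simp only [hb, map_sub]
  rw [hMb] at hmono
  have hab : ⟪b, M a⟫ = ⟪M b, a⟫ := (hMsa b a).symm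
  have hba : ⟪a, M b⟫ = ⟪M b, a⟫ := real_inner_comm _ _
  rw [hsum, map_add, inner_add_left, inner_add_right, inner_add_right, hab, hba]
  linarith
end

section
/- Let H be a real inner product space, M : H → H a continuous self-adjoint positive semidefinite linear map, T : H → Set(H) a monotone set-valued operator, and T̂ : H → H a map induced by (M, T). For ρ ∈ (0, 2], define F̂_ρ(w) := (1−ρ)w + ρ·T̂(w). Then F̂_ρ is M-nonexpansive: for all w, w' ∈ H, ‖F̂_ρ w − F̂_ρ w'‖_M ≤ ‖w − w'‖_M. (Proposition 2.2(d).) -/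
open scoped RealInnerProductSpace

/-- Proposition 2.2(d): F̂_ρ = (1−ρ)I + ρT̂ is M-nonexpansive for ρ ∈ (0, 2]. -/
theorem dPPM_relaxed_M_nonexpansive
    {H : Type*} [NormedAddCommGroup H] [InnerProductSpace ℝ H]
    (M : H →L[ℝ] H)
    (hMsa : ∀ w w' : H, ⟪M w, w'⟫ = ⟪w, M w'⟫)
    (hMpsd : ∀ w : H, 0 ≤ ⟪w, M w⟫)
    (T : H → Set H)
    (hT : ∀ w w' v v' : H, v ∈ T w → v' ∈ T w' → 0 ≤ ⟪v - v', w - w'⟫)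
    (That : H → H)
    (hThat : ∀ w : H, M w - M (That w) ∈ T (That w))
    (ρ : ℝ) (hρ0 : 0 < ρ) (hρ2 : ρ ≤ 2) :
    ∀ w w' : H,
      Real.sqrt ⟪((1 - ρ) • w + ρ • That w) - ((1 - ρ) • w' + ρ • That w'),
        M (((1 - ρ) • w + ρ • That w) - ((1 - ρ) • w' + ρ • That w'))⟫ ≤
      Real.sqrt ⟪w - w', M (w - w')⟫ := by
  intro w w'
  apply Real.sqrt_le_sqrt
  have hmono := hT _ _ _ _ (hThat w) (hThat w')
  obtain ⟨d, hd⟩ : ∃ d, d = w - w' := ⟨_, rfl⟩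
  obtain ⟨e, he⟩ : ∃ e, e = (w - w') - (That w - That w') := ⟨_, rfl⟩
  have hrelaxed : ((1 - ρ) • w + ρ • That w) - ((1 - ρ) • w' + ρ • That w') = d - ρ • e := by
    rw [hd, he]; module
  have hMe : (M w - M (That w)) - (M w' - M (That w')) = M e := by
    rw [he]; simp only [map_sub]; abel
  have hThat_sub : That w - That w' = d - e := by
    rw [hd, he]; abel
  rw [hMe, hThat_sub, inner_sub_right, hMsa, hMsa] at hmono
  have hsymm : ⟪d, M e⟫ = ⟪e, M d⟫ := by rw [← hMsa, real_inner_comm]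
  rw [hrelaxed, ← hd]
  simp only [map_sub, map_smul, inner_sub_left, inner_sub_right, real_inner_smul_left,
    real_inner_smul_right, hsymm]
  nlinarith [mul_nonneg hρ0.le hmono,
    mul_nonneg (mul_nonneg hρ0.le (sub_nonneg.2 hρ2)) (hMpsd e)]
end

section
/- Let V be a real vector space and let (w^k) and (ŵ^k) be sequences in V with ŵ⁰ = w⁰ and, for all k ≥ 0, w^{k+1} = w^k + (1/(k+2))·(ŵ^{k+1} − w^k) + (k/(k+2))·(ŵ^{k+1} − ŵ^k). Then for all k ≥ 0, w^{k+1} = (1/(k+2))·w⁰ + ((k+1)/(k+2))·ŵ^{k+1}. (This is the identity of Remark 2.1, showing that the acceleration step of the accelerated dPPM with α = 2 is exactly the Halpern iteration.) -/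
/-- Remark 2.1: the acceleration step of the accelerated dPPM with α = 2 is exactly
the Halpern iteration. -/
theorem acc_step_is_halpern
    {V : Type*} [AddCommGroup V] [Module ℝ V]
    (w wh : ℕ → V) (hwh0 : wh 0 = w 0)
    (hrec : ∀ k : ℕ, w (k + 1) = w k
      + (((k : ℝ) + 2)⁻¹) • (wh (k + 1) - w k)
      + ((k : ℝ) / ((k : ℝ) + 2)) • (wh (k + 1) - wh k)) :
    ∀ k : ℕ, w (k + 1) =
      (((k : ℝ) + 2)⁻¹) • w 0 + (((k : ℝ) + 1) / ((k : ℝ) + 2)) • wh (k + 1) := by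
  intro k
  induction k with
  | zero =>
    rw [hrec 0]
    push_cast
    module
  | succ k ih =>
    rw [hrec (k + 1), ih]
    have h₂ : (k : ℝ) + 2 ≠ 0 := by positivity
    have h₃ : (k : ℝ) + 1 + 2 ≠ 0 := by positivity
    push_cast
    match_scalars <;> field_simp <;> ring
end

section
/- In the two-block setting with the Σ-monotonicity assumptions, assume that Σ₁ + σB₁*B₁ + T₁ and Σ₂ + σB₂*B₂ + T₂ are positive definite. Fix v = (v_y, v_z, v_x) ∈ Y × Z × X and suppose that for i = 1, 2 the triple (ȳᵢ, z̄ᵢ, x̄ᵢ) ∈ Y × Z × X satisfies: v_y − (σB₁*B₁ + T₁)ȳᵢ − 2B₁*x̄ᵢ ∈ ∂f₁(ȳᵢ), v_z − B₂*x̄ᵢ − T₂z̄ᵢ ∈ ∂f₂(z̄ᵢ), and v_x = c − B₂z̄ᵢ + σ⁻¹x̄ᵢ. Then (ȳ₁, z̄₁, x̄₁) = (ȳ₂, z̄₂, x̄₂). (This is the single-valuedness of (M + T)⁻¹ established in Lemma 3.1.) -/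
open scoped RealInnerProductSpace

/-- Lemma 3.1 (single-valuedness of (M + T)⁻¹): under positive definiteness of
Σᵢ + σBᵢ*Bᵢ + Tᵢ, the triple solving the preconditioned inclusion for given data v
is unique. -/
theorem pADMM_resolvent_single_valued
    {Y Z X : Type*}
    [NormedAddCommGroup Y] [InnerProductSpace ℝ Y] [FiniteDimensional ℝ Y]
    [NormedAddCommGroup Z] [InnerProductSpace ℝ Z] [FiniteDimensional ℝ Z]
    [NormedAddCommGroup X] [InnerProductSpace ℝ X] [FiniteDimensional ℝ X]
    (B1 : Y →ₗ[ℝ] X) (B2 : Z →ₗ[ℝ] X) (c : X) (σ : ℝ) (hσ : 0 < σ)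
    (f1 : Y → ℝ) (f2 : Z → ℝ)
    (hf1 : ConvexOn ℝ Set.univ f1) (hf2 : ConvexOn ℝ Set.univ f2)
    (T1 : Y →ₗ[ℝ] Y) (T2 : Z →ₗ[ℝ] Z)
    (hT1sa : ∀ u v : Y, ⟪T1 u, v⟫ = ⟪u, T1 v⟫) (hT1psd : ∀ u : Y, 0 ≤ ⟪u, T1 u⟫)
    (hT2sa : ∀ u v : Z, ⟪T2 u, v⟫ = ⟪u, T2 v⟫) (hT2psd : ∀ u : Z, 0 ≤ ⟪u, T2 u⟫)
    (S1 : Y →ₗ[ℝ] Y) (S2 : Z →ₗ[ℝ] Z)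
    (hS1sa : ∀ u v : Y, ⟪S1 u, v⟫ = ⟪u, S1 v⟫) (hS1psd : ∀ u : Y, 0 ≤ ⟪u, S1 u⟫)
    (hS2sa : ∀ u v : Z, ⟪S2 u, v⟫ = ⟪u, S2 v⟫) (hS2psd : ∀ u : Z, 0 ≤ ⟪u, S2 u⟫)
    -- Σ-monotonicity of the subdifferentials
    (hS1mono : ∀ (y y' φ φ' : Y),
      (∀ v : Y, f1 y + ⟪φ, v - y⟫ ≤ f1 v) → (∀ v : Y, f1 y' + ⟪φ', v - y'⟫ ≤ f1 v) →
      ⟪y - y', S1 (y - y')⟫ ≤ ⟪φ - φ', y - y'⟫)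
    (hS2mono : ∀ (z z' ψ ψ' : Z),
      (∀ v : Z, f2 z + ⟪ψ, v - z⟫ ≤ f2 v) → (∀ v : Z, f2 z' + ⟪ψ', v - z'⟫ ≤ f2 v) →
      ⟪z - z', S2 (z - z')⟫ ≤ ⟪ψ - ψ', z - z'⟫)
    -- positive definiteness assumptions
    (hpd1 : ∀ u : Y, u ≠ 0 → 0 < ⟪u, S1 u + σ • B1.adjoint (B1 u) + T1 u⟫)
    (hpd2 : ∀ u : Z, u ≠ 0 → 0 < ⟪u, S2 u + σ • B2.adjoint (B2 u) + T2 u⟫)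
    -- fixed data v = (v_y, v_z, v_x)
    (vy : Y) (vz : Z) (vx : X)
    (ybar1 ybar2 : Y) (zbar1 zbar2 : Z) (xbar1 xbar2 : X)
    -- the inclusions for i = 1
    (h1y : ∀ v : Y, f1 ybar1 +
      ⟪vy - (σ • B1.adjoint (B1 ybar1) + T1 ybar1) - (2 : ℝ) • B1.adjoint xbar1,
        v - ybar1⟫ ≤ f1 v)
    (h1z : ∀ v : Z, f2 zbar1 +
      ⟪vz - B2.adjoint xbar1 - T2 zbar1, v - zbar1⟫ ≤ f2 v)
    (h1x : vx = c - B2 zbar1 + σ⁻¹ • xbar1)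
    -- the inclusions for i = 2
    (h2y : ∀ v : Y, f1 ybar2 +
      ⟪vy - (σ • B1.adjoint (B1 ybar2) + T1 ybar2) - (2 : ℝ) • B1.adjoint xbar2,
        v - ybar2⟫ ≤ f1 v)
    (h2z : ∀ v : Z, f2 zbar2 +
      ⟪vz - B2.adjoint xbar2 - T2 zbar2, v - zbar2⟫ ≤ f2 v)
    (h2x : vx = c - B2 zbar2 + σ⁻¹ • xbar2) :
    ybar1 = ybar2 ∧ zbar1 = zbar2 ∧ xbar1 = xbar2 := by
  have hx : xbar1 - xbar2 = σ • B2 (zbar1 - zbar2) := by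
    have h : σ⁻¹ • (xbar1 - xbar2) = B2 (zbar1 - zbar2) := by
      rw [map_sub, smul_sub, sub_eq_sub_iff_add_eq_add]
      linear_combination (norm := module) h2x - h1x
    rw [← h, smul_inv_smul₀ hσ.ne']
  have hz : zbar1 = zbar2 := by
    by_contra hne
    have hpos := hpd2 _ (sub_ne_zero.mpr hne)
    have hmono := hS2mono _ _ _ _ h1z h2z
    have hdiff : vz - B2.adjoint xbar1 - T2 zbar1 - (vz - B2.adjoint xbar2 - T2 zbar2)
        = -(σ • B2.adjoint (B2 (zbar1 - zbar2)) + T2 (zbar1 - zbar2)) := by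
      rw [← map_smul, ← hx, map_sub, map_sub]
      abel
    rw [hdiff, inner_neg_left, real_inner_comm _ (_ + _)] at hmono
    rw [add_assoc, inner_add_right] at hpos
    linarith
  subst hz
  have hxeq : xbar1 = xbar2 := by
    rwa [sub_self, map_zero, smul_zero, sub_eq_zero] at hx
  subst hxeq
  refine ⟨?_, rfl, rfl⟩
  by_contra hne
  have hpos := hpd1 _ (sub_ne_zero.mpr hne)
  have hmono := hS1mono _ _ _ _ h1y h2y
  have hdiff : vy - (σ • B1.adjoint (B1 ybar1) + T1 ybar1) - (2 : ℝ) • B1.adjoint xbar1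
      - (vy - (σ • B1.adjoint (B1 ybar2) + T1 ybar2) - (2 : ℝ) • B1.adjoint xbar1)
      = -(σ • B1.adjoint (B1 (ybar1 - ybar2)) + T1 (ybar1 - ybar2)) := by
    simp only [map_sub, smul_sub]
    abel
  rw [hdiff, inner_neg_left, real_inner_comm _ (_ + _)] at hmono
  rw [add_assoc, inner_add_right] at hpos
  linarith
end

section
/- In the two-block setting with the Σ-monotonicity assumptions, assume that Σ₁ + σB₁*B₁ + T₁ and Σ₂ + σB₂*B₂ + T₂ are positive definite. Then there exists a constant L ≥ 0 with the following property: whenever, for i = 1, 2, the triples (ȳᵢ, z̄ᵢ, x̄ᵢ) ∈ Y × Z × X and data vᵢ = (v_{iy}, v_{iz}, v_{ix}) ∈ Y × Z × X satisfy v_{iy} − (σB₁*B₁ + T₁)ȳᵢ − 2B₁*x̄ᵢ ∈ ∂f₁(ȳᵢ), v_{iz} − B₂*x̄ᵢ − T₂z̄ᵢ ∈ ∂f₂(z̄ᵢ), and v_{ix} = c − B₂z̄ᵢ + σ⁻¹x̄ᵢ, one has ‖(ȳ₁, z̄₁, x̄₁) − (ȳ₂, z̄₂, x̄₂)‖ ≤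 L·‖v₁ − v₂‖. (This is the Lipschitz continuity of (M + T)⁻¹ established in Lemma 3.1.) -/
open scoped RealInnerProductSpace

/-- A linear map on a finite-dimensional real inner product space with positive quadratic form
is coercive. -/
theorem exists_pos_mul_norm_sq_le_inner {E : Type*} [NormedAddCommGroup E]
    [InnerProductSpace ℝ E] [FiniteDimensional ℝ E] (A : E →ₗ[ℝ] E)
    (hA : ∀ u : E, u ≠ 0 → 0 < ⟪u, A u⟫) :
    ∃ α : ℝ, 0 < α ∧ ∀ u : E, α * ‖u‖ ^ 2 ≤ ⟪u, A u⟫ := by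
  rcases subsingleton_or_nontrivial E with hE | hE
  · exact ⟨1, one_pos, fun u => by simp [Subsingleton.elim u 0]⟩
  have hcont : Continuous fun u : E => ⟪u, A u⟫ :=
    continuous_id.inner A.continuous_of_finiteDimensional
  have : ProperSpace E := FiniteDimensional.proper_real E
  obtain ⟨w, hw, hmin⟩ := (isCompact_sphere (0 : E) 1).exists_isMinOn
    (NormedSpace.sphere_nonempty.2 zero_le_one) hcont.continuousOn
  have hw0 : w ≠ 0 := ne_zero_of_mem_unit_sphere ⟨w, hw⟩
  refine ⟨⟪w, A w⟫, hA w hw0, fun u => ?_⟩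
  rcases eq_or_ne u 0 with rfl | hu
  · simp
  have hu' : ‖u‖ ≠ 0 := norm_ne_zero_iff.2 hu
  have hmem : ‖u‖⁻¹ • u ∈ Metric.sphere (0 : E) 1 := by
    simp [norm_smul, hu']
  have h : ⟪w, A w⟫ ≤ ⟪‖u‖⁻¹ • u, A (‖u‖⁻¹ • u)⟫ := hmin hmem
  rw [map_smul, real_inner_smul_left, real_inner_smul_right] at h
  calc ⟪w, A w⟫ * ‖u‖ ^ 2 ≤ ‖u‖⁻¹ * (‖u‖⁻¹ * ⟪u, A u⟫) * ‖u‖ ^ 2 := by gcongr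
    _ = ⟪u, A u⟫ := by field_simp

theorem LinearMap.exists_nonneg_norm_apply_le {E F : Type*} [NormedAddCommGroup E]
    [NormedSpace ℝ E] [FiniteDimensional ℝ E] [NormedAddCommGroup F] [NormedSpace ℝ F]
    (B : E →ₗ[ℝ] F) : ∃ K : ℝ, 0 ≤ K ∧ ∀ u : E, ‖B u‖ ≤ K * ‖u‖ :=
  ⟨‖LinearMap.toContinuousLinearMap B‖, norm_nonneg _,
    fun u => (LinearMap.toContinuousLinearMap B).le_opNorm u⟩

theorem norm_le_of_mul_norm_sq_le {E : Type*} [NormedAddCommGroup E] {α C : ℝ} {u : E}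
    (hα : 0 < α) (hC : 0 ≤ C) (h : α * ‖u‖ ^ 2 ≤ C * ‖u‖) : ‖u‖ ≤ α⁻¹ * C := by
  rcases (norm_nonneg u).eq_or_lt' with hu | hu
  · rw [hu]; positivity
  · rw [le_inv_mul_iff₀ hα]
    exact le_of_mul_le_mul_right (by linarith [sq ‖u‖]) hu

/-- The quadratic form of `S + σ • B* B + T`, expanded. -/
theorem inner_add_smul_adjoint_add {E F : Type*} [NormedAddCommGroup E]
    [InnerProductSpace ℝ E] [FiniteDimensional ℝ E] [NormedAddCommGroup F]
    [InnerProductSpace ℝ F] [FiniteDimensional ℝ F] (S T : E →ₗ[ℝ] E) (B : E →ₗ[ℝ] F)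
    (σ : ℝ) (u : E) :
    ⟪u, (S + σ • (B.adjoint ∘ₗ B) + T) u⟫ = ⟪u, S u⟫ + σ * ‖B u‖ ^ 2 + ⟪u, T u⟫ := by
  simp [inner_add_right, real_inner_smul_right, LinearMap.adjoint_inner_right]

/-- Lemma 3.1 (Lipschitz continuity of (M + T)⁻¹): under positive definiteness of
Σᵢ + σBᵢ*Bᵢ + Tᵢ, there is a constant L ≥ 0 such that the solution triple of the
preconditioned inclusion depends Lipschitz-continuously on the data v. -/
theorem pADMM_resolvent_lipschitz
    {Y Z X : Type*}
    [NormedAddCommGroup Y] [InnerProductSpace ℝ Y] [FiniteDimensional ℝ Y]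
    [NormedAddCommGroup Z] [InnerProductSpace ℝ Z] [FiniteDimensional ℝ Z]
    [NormedAddCommGroup X] [InnerProductSpace ℝ X] [FiniteDimensional ℝ X]
    (B1 : Y →ₗ[ℝ] X) (B2 : Z →ₗ[ℝ] X) (c : X) (σ : ℝ) (hσ : 0 < σ)
    (f1 : Y → ℝ) (f2 : Z → ℝ)
    (hf1 : ConvexOn ℝ Set.univ f1) (hf2 : ConvexOn ℝ Set.univ f2)
    (T1 : Y →ₗ[ℝ] Y) (T2 : Z →ₗ[ℝ] Z)
    (hT1sa : ∀ u v : Y, ⟪T1 u, v⟫ = ⟪u, T1 v⟫) (hT1psd : ∀ u : Y, 0 ≤ ⟪u, T1 u⟫)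
    (hT2sa : ∀ u v : Z, ⟪T2 u, v⟫ = ⟪u, T2 v⟫) (hT2psd : ∀ u : Z, 0 ≤ ⟪u, T2 u⟫)
    (S1 : Y →ₗ[ℝ] Y) (S2 : Z →ₗ[ℝ] Z)
    (hS1sa : ∀ u v : Y, ⟪S1 u, v⟫ = ⟪u, S1 v⟫) (hS1psd : ∀ u : Y, 0 ≤ ⟪u, S1 u⟫)
    (hS2sa : ∀ u v : Z, ⟪S2 u, v⟫ = ⟪u, S2 v⟫) (hS2psd : ∀ u : Z, 0 ≤ ⟪u, S2 u⟫)
    (hS1mono : ∀ (y y' φ φ' : Y),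
      (∀ v : Y, f1 y + ⟪φ, v - y⟫ ≤ f1 v) → (∀ v : Y, f1 y' + ⟪φ', v - y'⟫ ≤ f1 v) →
      ⟪y - y', S1 (y - y')⟫ ≤ ⟪φ - φ', y - y'⟫)
    (hS2mono : ∀ (z z' ψ ψ' : Z),
      (∀ v : Z, f2 z + ⟪ψ, v - z⟫ ≤ f2 v) → (∀ v : Z, f2 z' + ⟪ψ', v - z'⟫ ≤ f2 v) →
      ⟪z - z', S2 (z - z')⟫ ≤ ⟪ψ - ψ', z - z'⟫)
    (hpd1 : ∀ u : Y, u ≠ 0 → 0 < ⟪u, S1 u + σ • B1.adjoint (B1 u) + T1 u⟫)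
    (hpd2 : ∀ u : Z, u ≠ 0 → 0 < ⟪u, S2 u + σ • B2.adjoint (B2 u) + T2 u⟫) :
    ∃ L : ℝ, 0 ≤ L ∧
      ∀ (v1y v2y : Y) (v1z v2z : Z) (v1x v2x : X)
        (ybar1 ybar2 : Y) (zbar1 zbar2 : Z) (xbar1 xbar2 : X),
        (∀ v : Y, f1 ybar1 +
          ⟪v1y - (σ • B1.adjoint (B1 ybar1) + T1 ybar1) - (2 : ℝ) • B1.adjoint xbar1,
            v - ybar1⟫ ≤ f1 v) →
        (∀ v : Z, f2 zbar1 +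
          ⟪v1z - B2.adjoint xbar1 - T2 zbar1, v - zbar1⟫ ≤ f2 v) →
        v1x = c - B2 zbar1 + σ⁻¹ • xbar1 →
        (∀ v : Y, f1 ybar2 +
          ⟪v2y - (σ • B1.adjoint (B1 ybar2) + T1 ybar2) - (2 : ℝ) • B1.adjoint xbar2,
            v - ybar2⟫ ≤ f1 v) →
        (∀ v : Z, f2 zbar2 +
          ⟪v2z - B2.adjoint xbar2 - T2 zbar2, v - zbar2⟫ ≤ f2 v) →
        v2x = c - B2 zbar2 + σ⁻¹ • xbar2 →
        Real.sqrt (‖ybar1 - ybar2‖ ^ 2 + ‖zbar1 - zbar2‖ ^ 2 + ‖xbar1 - xbar2‖ ^ 2) ≤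
          L * Real.sqrt (‖v1y - v2y‖ ^ 2 + ‖v1z - v2z‖ ^ 2 + ‖v1x - v2x‖ ^ 2) := by
  obtain ⟨α, hα, hα'⟩ := exists_pos_mul_norm_sq_le_inner
    (S1 + σ • (B1.adjoint ∘ₗ B1) + T1) hpd1
  obtain ⟨β, hβ, hβ'⟩ := exists_pos_mul_norm_sq_le_inner
    (S2 + σ • (B2.adjoint ∘ₗ B2) + T2) hpd2
  obtain ⟨K1, hK1, hB1⟩ := B1.exists_nonneg_norm_apply_le
  obtain ⟨K2, hK2, hB2⟩ := B2.exists_nonneg_norm_apply_le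
  simp only [inner_add_smul_adjoint_add] at hα' hβ'
  set Cz : ℝ := β⁻¹ * (1 + σ * K2) with hCz
  set Cx : ℝ := σ * (1 + K2 * Cz) with hCx
  set Cy : ℝ := α⁻¹ * (1 + 2 * Cx * K1) with hCy
  have hCz0 : 0 ≤ Cz := by positivity
  have hCx0 : 0 ≤ Cx := by positivity
  have hCy0 : 0 ≤ Cy := by positivity
  refine ⟨Cy + Cz + Cx, by positivity, ?_⟩
  intro v1y v2y v1z v2z v1x v2x y1 y2 z1 z2 x1 x2 hy1 hz1 hx1 hy2 hz2 hx2
  have hmono1 := hS1mono _ _ _ _ hy1 hy2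
  have hmono2 := hS2mono _ _ _ _ hz1 hz2
  have hdx : x1 - x2 = σ • (v1x - v2x) + σ • B2 (z1 - z2) := by
    rw [hx1, hx2, map_sub]
    simp only [smul_sub, smul_add, smul_inv_smul₀ hσ.ne']
    abel
  rw [show v1y - (σ • B1.adjoint (B1 y1) + T1 y1) - (2 : ℝ) • B1.adjoint x1 -
      (v2y - (σ • B1.adjoint (B1 y2) + T1 y2) - (2 : ℝ) • B1.adjoint x2) =
      (v1y - v2y) - σ • B1.adjoint (B1 (y1 - y2)) - T1 (y1 - y2) -
        (2 : ℝ) • B1.adjoint (x1 - x2) by simp only [map_sub, smul_sub]; abel] at hmono1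
  rw [show v1z - B2.adjoint x1 - T2 z1 - (v2z - B2.adjoint x2 - T2 z2) =
      (v1z - v2z) - B2.adjoint (x1 - x2) - T2 (z1 - z2) by
        simp only [map_sub]; abel] at hmono2
  have hαy := hα' (y1 - y2)
  have hβz := hβ' (z1 - z2)
  have hB1y := hB1 (y1 - y2)
  have hB2z := hB2 (z1 - z2)
  set N : ℝ := Real.sqrt (‖v1y - v2y‖ ^ 2 + ‖v1z - v2z‖ ^ 2 + ‖v1x - v2x‖ ^ 2) with hN
  have haN : ‖v1y - v2y‖ ≤ N := Real.le_sqrt_of_sq_le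
    (by nlinarith [sq_nonneg ‖v1z - v2z‖, sq_nonneg ‖v1x - v2x‖])
  have hbN : ‖v1z - v2z‖ ≤ N := Real.le_sqrt_of_sq_le
    (by nlinarith [sq_nonneg ‖v1y - v2y‖, sq_nonneg ‖v1x - v2x‖])
  have hdN : ‖v1x - v2x‖ ≤ N := Real.le_sqrt_of_sq_le
    (by nlinarith [sq_nonneg ‖v1y - v2y‖, sq_nonneg ‖v1z - v2z‖])
  have hN0 : 0 ≤ N := Real.sqrt_nonneg _
  clear_value N
  generalize y1 - y2 = y at *
  generalize z1 - z2 = z at *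
  generalize x1 - x2 = x at *
  generalize v1y - v2y = a at *
  generalize v1z - v2z = b at *
  generalize v1x - v2x = d at *
  simp only [inner_sub_left, real_inner_smul_left, LinearMap.adjoint_inner_left,
    real_inner_self_eq_norm_sq] at hmono1 hmono2
  have hz : ‖z‖ ≤ Cz * N := by
    have h1 : ⟪b, z⟫ ≤ N * ‖z‖ := (real_inner_le_norm b z).trans (by gcongr)
    have h2 : -⟪d, B2 z⟫ ≤ N * (K2 * ‖z‖) :=
      (neg_le_abs _).trans ((abs_real_inner_le_norm d (B2 z)).trans (by gcongr))
    have h3 : ⟪x, B2 z⟫ = σ * ⟪d, B2 z⟫ + σ * ‖B2 z‖ ^ 2 := by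
      rw [hdx, inner_add_left, real_inner_smul_left, real_inner_smul_left,
        real_inner_self_eq_norm_sq]
    have h4 := mul_le_mul_of_nonneg_left h2 hσ.le
    have hT := real_inner_comm z (T2 z)
    have hS := real_inner_comm z (S2 z)
    have h := norm_le_of_mul_norm_sq_le (u := z) (C := (1 + σ * K2) * N) hβ (by positivity)
      (by linarith)
    rwa [← mul_assoc] at h
  have hx : ‖x‖ ≤ Cx * N := by
    calc ‖x‖ ≤ ‖σ • d‖ + ‖σ • B2 z‖ := hdx ▸ norm_add_le _ _
      _ = σ * ‖d‖ + σ * ‖B2 z‖ := by simp [norm_smul, abs_of_pos hσ]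
      _ ≤ σ * N + σ * (K2 * (Cz * N)) := by
        gcongr
        exact hB2z.trans (by gcongr)
      _ = Cx * N := by rw [hCx]; ring
  have hy : ‖y‖ ≤ Cy * N := by
    have h1 : ⟪a, y⟫ ≤ N * ‖y‖ := (real_inner_le_norm a y).trans (by gcongr)
    have h2 : -⟪x, B1 y⟫ ≤ (Cx * N) * (K1 * ‖y‖) :=
      (neg_le_abs _).trans ((abs_real_inner_le_norm x (B1 y)).trans (by gcongr))
    have hT := real_inner_comm y (T1 y)
    have hS := real_inner_comm y (S1 y)
    have h := norm_le_of_mul_norm_sq_le (u := y) (C := (1 + 2 * Cx * K1) * N) hα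
      (by positivity) (by linarith)
    rwa [← mul_assoc] at h
  calc Real.sqrt (‖y‖ ^ 2 + ‖z‖ ^ 2 + ‖x‖ ^ 2) ≤ ‖y‖ + ‖z‖ + ‖x‖ := by
        refine Real.sqrt_le_iff.2 ⟨by positivity, ?_⟩
        have hyz : 0 ≤ ‖y‖ * ‖z‖ := by positivity
        have hyx : 0 ≤ ‖y‖ * ‖x‖ := by positivity
        have hzx : 0 ≤ ‖z‖ * ‖x‖ := by positivity
        linarith [show (‖y‖ + ‖z‖ + ‖x‖) ^ 2 = ‖y‖ ^ 2 + ‖z‖ ^ 2 + ‖x‖ ^ 2 +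
          2 * (‖y‖ * ‖z‖) + 2 * (‖y‖ * ‖x‖) + 2 * (‖z‖ * ‖x‖) by ring]
    _ ≤ Cy * N + Cz * N + Cx * N := by gcongr
    _ = (Cy + Cz + Cx) * N := by ring
end

section
/- In the two-block setting, let w = (y, z, x) ∈ W, and suppose w̄ = (ȳ, z̄, x̄) ∈ W is produced by one pADMM iteration from w: (i) z̄ minimizes over Z the function z' ↦ L_σ(y, z'; x) + (1/2)⟨z' − z, T₂(z' − z)⟩; (ii) x̄ = x + σ(B₁y + B₂z̄ − c); (iii) ȳ minimizes over Y the function y' ↦ L_σ(y', z̄; x̄) + (1/2)⟨y' − y, T₁(y' − y)⟩. Then the following three relations hold: (σB₁*B₁ + T₁)(y − ȳ) + B₁*(x − 2x̄) ∈ ∂f₁(ȳ); T₂(z − z̄) − B₂*x̄ ∈ ∂f₂(z̄); and B₁(y − ȳ) + σ⁻¹(x − x̄) = c − B₁ȳ − B₂z̄. (These relations say precisely that M(w − w̄) ∈ T(w̄) for the KKT operator T and preconditioner M, which is the one-iteration characterization underlying Proposition 3.2: the pADMM coincides with the degenerate proximal point method.) -/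
open scoped RealInnerProductSpace

/-- The augmented Lagrangian of the two-block problem. -/
noncomputable def augLag {Y Z X : Type*}
    [NormedAddCommGroup Y] [InnerProductSpace ℝ Y]
    [NormedAddCommGroup Z] [InnerProductSpace ℝ Z]
    [NormedAddCommGroup X] [InnerProductSpace ℝ X]
    (f1 : Y → ℝ) (f2 : Z → ℝ) (B1 : Y →ₗ[ℝ] X) (B2 : Z →ₗ[ℝ] X) (c : X) (σ : ℝ)
    (y : Y) (z : Z) (x : X) : ℝ :=
  f1 y + f2 z + ⟪x, B1 y + B2 z - c⟫ + (σ / 2) * ‖B1 y + B2 z - c‖ ^ 2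

/-- A real number bounded above by `t * K` for all `t ∈ (0, 1]` is nonpositive. -/
theorem nonpos_of_forall_le_mul {a K : ℝ} (h : ∀ t : ℝ, 0 < t → t ≤ 1 → a ≤ t * K) : a ≤ 0 := by
  by_contra! ha
  have hK : 0 < |K| + a := by positivity
  have h1 := h (a / (2 * (|K| + a))) (by positivity) (by
    rw [div_le_one (by positivity)]
    linarith [abs_nonneg K])
  rw [div_mul_eq_mul_div, le_div_iff₀ (by positivity)] at h1
  nlinarith [le_abs_self K, abs_nonneg K]

/-- First-order optimality condition for a convex function plus a proximal augmented-Lagrangian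
term: a minimizer yields a subgradient. -/
theorem subgradient_of_forall_prox_le {E F : Type*}
    [NormedAddCommGroup E] [InnerProductSpace ℝ E] [FiniteDimensional ℝ E]
    [NormedAddCommGroup F] [InnerProductSpace ℝ F] [FiniteDimensional ℝ F]
    {f : E → ℝ} (hf : ConvexOn ℝ Set.univ f) (B : E →ₗ[ℝ] F) (T : E →ₗ[ℝ] E)
    (hT : ∀ u v : E, ⟪T u, v⟫ = ⟪u, T v⟫) (σ : ℝ) (p e : F) (u₀ ubar : E)
    (hmin : ∀ u : E,
      f ubar + ⟪p, B ubar + e⟫ + σ / 2 * ‖B ubar + e‖ ^ 2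
        + 1 / 2 * ⟪ubar - u₀, T (ubar - u₀)⟫ ≤
      f u + ⟪p, B u + e⟫ + σ / 2 * ‖B u + e‖ ^ 2 + 1 / 2 * ⟪u - u₀, T (u - u₀)⟫) (v : E) :
    f ubar + ⟪T (u₀ - ubar) - B.adjoint (p + σ • (B ubar + e)), v - ubar⟫ ≤ f v := by
  set d := v - ubar with hd
  have hg : ⟪T (u₀ - ubar) - B.adjoint (p + σ • (B ubar + e)), d⟫ =
      -⟪ubar - u₀, T d⟫ - ⟪p, B d⟫ - σ * ⟪B ubar + e, B d⟫ := by
    rw [inner_sub_left, hT, LinearMap.adjoint_inner_left, inner_add_left, real_inner_smul_left,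
      ← neg_sub ubar u₀, inner_neg_left]
    ring
  rw [← sub_nonpos]
  refine nonpos_of_forall_le_mul (K := σ / 2 * ‖B d‖ ^ 2 + 1 / 2 * ⟪d, T d⟫) fun t ht ht1 => ?_
  have hconv : f (ubar + t • d) ≤ (1 - t) * f ubar + t * f v := by
    have h := hf.2 (Set.mem_univ ubar) (Set.mem_univ v) (sub_nonneg.2 ht1) ht.le (by ring)
    rwa [show (1 - t) • ubar + t • v = ubar + t • d by rw [hd]; module] at h
  have h := hmin (ubar + t • d)
  have hB : B (ubar + t • d) + e = (B ubar + e) + t • B d := by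
    rw [map_add, map_smul]; abel
  have hsymm : ⟪d, T (ubar - u₀)⟫ = ⟪ubar - u₀, T d⟫ := by rw [← hT, real_inner_comm]
  have hq : ⟪ubar + t • d - u₀, T (ubar + t • d - u₀)⟫ =
      ⟪ubar - u₀, T (ubar - u₀)⟫ + 2 * t * ⟪ubar - u₀, T d⟫ + t ^ 2 * ⟪d, T d⟫ := by
    rw [show ubar + t • d - u₀ = (ubar - u₀) + t • d by abel, map_add, map_smul]
    simp only [inner_add_left, inner_add_right, real_inner_smul_left, real_inner_smul_right, hsymm]
    ring
  rw [hB, hq, inner_add_right _ (B ubar + e) (t • B d), real_inner_smul_right,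
    norm_add_sq_real (B ubar + e) (t • B d), real_inner_smul_right, norm_smul, mul_pow, Real.norm_eq_abs, sq_abs] at h
  rw [hg]
  refine le_of_mul_le_mul_left ?_ ht
  linarith

/-- One pADMM iteration satisfies M(w − w̄) ∈ T(w̄): the one-iteration characterization
underlying Proposition 3.2 (pADMM = degenerate PPM). -/
theorem pADMM_one_iteration_characterization
    {Y Z X : Type*}
    [NormedAddCommGroup Y] [InnerProductSpace ℝ Y] [FiniteDimensional ℝ Y]
    [NormedAddCommGroup Z] [InnerProductSpace ℝ Z] [FiniteDimensional ℝ Z]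
    [NormedAddCommGroup X] [InnerProductSpace ℝ X] [FiniteDimensional ℝ X]
    (B1 : Y →ₗ[ℝ] X) (B2 : Z →ₗ[ℝ] X) (c : X) (σ : ℝ) (hσ : 0 < σ)
    (f1 : Y → ℝ) (f2 : Z → ℝ)
    (hf1 : ConvexOn ℝ Set.univ f1) (hf2 : ConvexOn ℝ Set.univ f2)
    (T1 : Y →ₗ[ℝ] Y) (T2 : Z →ₗ[ℝ] Z)
    (hT1sa : ∀ u v : Y, ⟪T1 u, v⟫ = ⟪u, T1 v⟫) (hT1psd : ∀ u : Y, 0 ≤ ⟪u, T1 u⟫)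
    (hT2sa : ∀ u v : Z, ⟪T2 u, v⟫ = ⟪u, T2 v⟫) (hT2psd : ∀ u : Z, 0 ≤ ⟪u, T2 u⟫)
    (y ybar : Y) (z zbar : Z) (x xbar : X)
    -- (i) z̄ minimizes z' ↦ L_σ(y, z'; x) + (1/2)⟨z' − z, T₂(z' − z)⟩
    (hzbar : ∀ z' : Z,
      augLag f1 f2 B1 B2 c σ y zbar x + (1 / 2) * ⟪zbar - z, T2 (zbar - z)⟫ ≤
      augLag f1 f2 B1 B2 c σ y z' x + (1 / 2) * ⟪z' - z, T2 (z' - z)⟫)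
    -- (ii) multiplier update
    (hxbar : xbar = x + σ • (B1 y + B2 zbar - c))
    -- (iii) ȳ minimizes y' ↦ L_σ(y', z̄; x̄) + (1/2)⟨y' − y, T₁(y' − y)⟩
    (hybar : ∀ y' : Y,
      augLag f1 f2 B1 B2 c σ ybar zbar xbar + (1 / 2) * ⟪ybar - y, T1 (ybar - y)⟫ ≤
      augLag f1 f2 B1 B2 c σ y' zbar xbar + (1 / 2) * ⟪y' - y, T1 (y' - y)⟫) :
    (∀ y' : Y, f1 ybar +
      ⟪σ • B1.adjoint (B1 (y - ybar)) + T1 (y - ybar) + B1.adjoint (x - (2 : ℝ) • xbar),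
        y' - ybar⟫ ≤ f1 y') ∧
    (∀ z' : Z, f2 zbar +
      ⟪T2 (z - zbar) - B2.adjoint xbar, z' - zbar⟫ ≤ f2 z') ∧
    B1 (y - ybar) + σ⁻¹ • (x - xbar) = c - B1 ybar - B2 zbar := by
  have hr : σ • (B1 ybar + (B2 zbar - c)) = xbar - x - σ • B1 (y - ybar) := by
    rw [hxbar, map_sub]; module
  refine ⟨fun y' => ?_, fun z' => ?_, ?_⟩
  · have h := subgradient_of_forall_prox_le hf1 B1 T1 hT1sa σ xbar (B2 zbar - c) y ybar
      (fun u => by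
        have := hybar u
        simp only [augLag, add_sub_assoc] at this
        linarith) y'
    rw [hr] at h
    convert h using 3
    simp only [map_add, map_sub, map_smul]
    module
  · have h := subgradient_of_forall_prox_le hf2 B2 T2 hT2sa σ x (B1 y - c) z zbar
      (fun u => by
        have := hzbar u
        simp only [augLag, add_sub_right_comm, add_comm (B1 y - c)] at this
        linarith) z'
    rwa [show x + σ • (B2 zbar + (B1 y - c)) = xbar by rw [hxbar]; module] at h
  · rw [hxbar, sub_add_cancel_left, smul_neg, inv_smul_smul₀ hσ.ne', map_sub]
    abel
end

section
/- In the two-block setting, let (y*, z*, x*) ∈ Y × Z × X be a KKT point, and let (y, z, x) ∈ W and (ȳ, z̄, x̄) ∈ W satisfy the optimality inclusions −B₂*x̄ − T₂(z̄ − z) ∈ ∂f₂(z̄) and −B₁*(x̄ + σ(B₁ȳ + B₂z̄ − c)) − T₁(ȳ − y) ∈ ∂f₁(ȳ). Then the primal objective function value gap satisfies f₁(ȳ) + f₂(z̄) − f₁(y*) − f₂(z*) ≤ ⟨σB₁(y* − ȳ) − x̄, B₁ȳ + B₂z̄ − c⟩ + ⟨y* − ȳ, T₁(ȳ − y)⟩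 + ⟨z* − z̄, T₂(z̄ − z)⟩. (This is the upper bound (obj-upperbound) on the primal objective function value gap.) -/
open scoped RealInnerProductSpace

/-- Upper bound (obj-upperbound) on the primal objective function value gap. -/
theorem primal_gap_upper_bound
    {Y Z X : Type*}
    [NormedAddCommGroup Y] [InnerProductSpace ℝ Y] [FiniteDimensional ℝ Y]
    [NormedAddCommGroup Z] [InnerProductSpace ℝ Z] [FiniteDimensional ℝ Z]
    [NormedAddCommGroup X] [InnerProductSpace ℝ X] [FiniteDimensional ℝ X]
    (B1 : Y →ₗ[ℝ] X) (B2 : Z →ₗ[ℝ] X) (c : X) (σ : ℝ) (hσ : 0 < σ)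
    (f1 : Y → ℝ) (f2 : Z → ℝ)
    (hf1 : ConvexOn ℝ Set.univ f1) (hf2 : ConvexOn ℝ Set.univ f2)
    (T1 : Y →ₗ[ℝ] Y) (T2 : Z →ₗ[ℝ] Z)
    (hT1sa : ∀ u v : Y, ⟪T1 u, v⟫ = ⟪u, T1 v⟫) (hT1psd : ∀ u : Y, 0 ≤ ⟪u, T1 u⟫)
    (hT2sa : ∀ u v : Z, ⟪T2 u, v⟫ = ⟪u, T2 v⟫) (hT2psd : ∀ u : Z, 0 ≤ ⟪u, T2 u⟫)
    (ystar : Y) (zstar : Z) (xstar : X)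
    (hKKT1 : ∀ y' : Y, f1 ystar + ⟪-(B1.adjoint xstar), y' - ystar⟫ ≤ f1 y')
    (hKKT2 : ∀ z' : Z, f2 zstar + ⟪-(B2.adjoint xstar), z' - zstar⟫ ≤ f2 z')
    (hKKT3 : B1 ystar + B2 zstar = c)
    (y ybar : Y) (z zbar : Z) (x xbar : X)
    (h2 : ∀ z' : Z, f2 zbar + ⟪-(B2.adjoint xbar) - T2 (zbar - z), z' - zbar⟫ ≤ f2 z')
    (h3 : ∀ y' : Y, f1 ybar +
      ⟪-(B1.adjoint (xbar + σ • (B1 ybar + B2 zbar - c))) - T1 (ybar - y), y' - ybar⟫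
      ≤ f1 y') :
    f1 ybar + f2 zbar - f1 ystar - f2 zstar ≤
      ⟪σ • B1 (ystar - ybar) - xbar, B1 ybar + B2 zbar - c⟫
      + ⟪ystar - ybar, T1 (ybar - y)⟫ + ⟪zstar - zbar, T2 (zbar - z)⟫ := by
  have hy := h3 ystar
  have hz := h2 zstar
  have hr : B1 (ystar - ybar) + B2 (zstar - zbar) = -(B1 ybar + B2 zbar - c) := by
    rw [← hKKT3, map_sub, map_sub]
    abel
  have hx : ⟪xbar, B1 (ystar - ybar)⟫ + ⟪xbar, B2 (zstar - zbar)⟫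
      = -⟪xbar, B1 ybar + B2 zbar - c⟫ := by
    rw [← inner_add_right, hr, inner_neg_right]
  rw [inner_sub_left, inner_neg_left, LinearMap.adjoint_inner_left, inner_add_left,
    real_inner_smul_left, real_inner_comm (B1 (ystar - ybar)) (B1 ybar + B2 zbar - c)] at hy
  rw [inner_sub_left, inner_neg_left, LinearMap.adjoint_inner_left] at hz
  rw [inner_sub_left, real_inner_smul_left, real_inner_comm (T1 _), real_inner_comm (T2 _)]
  linarith
end
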